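/- Let ω, σ be weights on ℝⁿ with [ω]_{A∞} < ∞ and [σ]_{A∞} < ∞, let 𝒮 be an η-sparse collection of dyadic cubes, r ∈ (0,∞), α ∈ (0,1], and 1 < p ≤ q < ∞ with −α + 1/q + 1/p' ≥ 0. Then there is a constant C depending only on n, p, q, r, α, η such that the testing constant 𝒯 satisfies: 𝒯 ≤ C · [ω,σ]_{A^α_{pq}(𝒮)}^r · [σ]_{A∞}^{1−(1−r/p)²} [ω]_{A∞}^{(1−r/p)²} in the case that p = q, α < 1 and p > r; and 𝒯 ≤ C · [ω,σ]_{A^α_{pq}(𝒮)}^r · [σ]_{A∞}^{r/q} in all other cases. -/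

import Mathlib

open MeasureTheory ENNReal Set

noncomputable section

/-- An axis-parallel (closed) cube in ℝⁿ with corner `corner` and side length `side > 0`. -/
structure Cube (n : ℕ) where
  corner : Fin n → ℝ
  side : ℝ
  side_pos : 0 < side

namespace Cube

/-- The set of points of the cube. -/
def carrier {n : ℕ} (Q : Cube n) : Set (Fin n → ℝ) :=
  {x | ∀ i, Q.corner i ≤ x i ∧ x i ≤ Q.corner i + Q.side}

/-- The volume `|Q|` of the cube. -/
def vol {n : ℕ} (Q : Cube n) : ℝ := Q.side ^ n

/-- `Q` is a cube of the standard dyadic grid: `Q = 2^{-j}([0,1]^n + m)`. -/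
def IsDyadic {n : ℕ} (Q : Cube n) : Prop :=
  ∃ (j : ℤ) (m : Fin n → ℤ),
    Q.side = (2 : ℝ) ^ (-j) ∧ ∀ i, Q.corner i = (m i : ℝ) * (2 : ℝ) ^ (-j)

end Cube

/-- `η`-sparseness of a collection of cubes: there are pairwise disjoint measurable
subsets `E Q ⊆ Q` with `|E Q| ≥ η |Q|`. -/
def IsSparse {n : ℕ} (η : ℝ) (S : Set (Cube n)) : Prop :=
  ∃ E : Cube n → Set (Fin n → ℝ),
    (∀ Q ∈ S, MeasurableSet (E Q)) ∧ (∀ Q ∈ S, E Q ⊆ Q.carrier) ∧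
    (S.Pairwise (fun Q Q' => Disjoint (E Q) (E Q'))) ∧
    (∀ Q ∈ S, ENNReal.ofReal (η * Q.vol) ≤ volume (E Q))

/-- A weight: a nonnegative locally integrable function on ℝⁿ. -/
def IsWeight {n : ℕ} (w : (Fin n → ℝ) → ℝ) : Prop :=
  MeasureTheory.LocallyIntegrable w volume ∧ ∀ x, 0 ≤ w x

/-- `ω(Q) = ∫_Q ω`. -/
def wMass {n : ℕ} (w : (Fin n → ℝ) → ℝ) (Q : Cube n) : ℝ≥0∞ :=
  ∫⁻ x in Q.carrier, ENNReal.ofReal (w x)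

/-- The weighted `L^s` (quasi)norm `‖f‖_{L^s_w} = (∫ |f|^s w)^{1/s}`, valued in `ℝ≥0∞`. -/
def wNorm {n : ℕ} (s : ℝ) (w f : (Fin n → ℝ) → ℝ) : ℝ≥0∞ :=
  (∫⁻ x, ENNReal.ofReal (|f x| ^ s) * ENNReal.ofReal (w x)) ^ (1 / s)

/-- The weighted `L^s` (quasi)norm of an `ℝ≥0∞`-valued function. -/
def eNorm {n : ℕ} (s : ℝ) (w : (Fin n → ℝ) → ℝ) (g : (Fin n → ℝ) → ℝ≥0∞) : ℝ≥0∞ :=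
  (∫⁻ x, g x ^ s * ENNReal.ofReal (w x)) ^ (1 / s)

/-- `Σ_{Q ∈ D} g(Q) 1_Q`. -/
def cubeSum {n : ℕ} (D : Set (Cube n)) (g : Cube n → ℝ≥0∞) (x : Fin n → ℝ) : ℝ≥0∞ :=
  ∑' Q : D, Q.1.carrier.indicator (fun _ => g Q.1) x

/-- The sparse operator `A^{r,α}_S f = (Σ_{Q∈S} (|Q|^{-α} ∫_Q f)^r 1_Q)^{1/r}`
(for nonnegative `f`; negative values are truncated). -/
def sparseOp {n : ℕ} (S : Set (Cube n)) (r α : ℝ) (f : (Fin n → ℝ) → ℝ)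
    (x : Fin n → ℝ) : ℝ≥0∞ :=
  (cubeSum S
      (fun Q => ((ENNReal.ofReal Q.vol) ^ (-α) * ∫⁻ y in Q.carrier, ENNReal.ofReal (f y)) ^ r)
      x) ^ (1 / r)

/-- The Hardy–Littlewood maximal function over axis-parallel cubes. -/
def maximal {n : ℕ} (w : (Fin n → ℝ) → ℝ) (x : Fin n → ℝ) : ℝ≥0∞ :=
  ⨆ (Q : Cube n) (_ : x ∈ Q.carrier),
    (ENNReal.ofReal Q.vol)⁻¹ * ∫⁻ y in Q.carrier, ENNReal.ofReal |w y|

/-- The Fujii–Wilson `A∞`-characteristic `[w]_{A∞} = sup_Q ω(Q)⁻¹ ∫_Q M(1_Q ω)`. -/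
def AinfChar {n : ℕ} (w : (Fin n → ℝ) → ℝ) : ℝ≥0∞ :=
  ⨆ Q : Cube n, (wMass w Q)⁻¹ * ∫⁻ x in Q.carrier, maximal (Q.carrier.indicator w) x

/-- The two-weight characteristic
`[ω,σ]_{A^α_{pq}(S)} = sup_{Q∈S} |Q|^{-α} ω(Q)^{1/q} σ(Q)^{1/p'}` (here `1/p' = 1 - 1/p`). -/
def twoWeightChar {n : ℕ} (p q α : ℝ) (S : Set (Cube n)) (w σ' : (Fin n → ℝ) → ℝ) : ℝ≥0∞ :=
  ⨆ Q ∈ S, (ENNReal.ofReal Q.vol) ^ (-α) * wMass w Q ^ (1 / q) * wMass σ' Q ^ (1 - 1 / p)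

/-- The one-weight characteristic
`[w]_{A_{pq}} = sup_Q (|Q|⁻¹ ∫_Q w^q)(|Q|⁻¹ ∫_Q w^{-p'})^{q/p'}`, `p' = p/(p-1)`. -/
def ApqChar {n : ℕ} (p q : ℝ) (w : (Fin n → ℝ) → ℝ) : ℝ≥0∞ :=
  ⨆ Q : Cube n,
    ((ENNReal.ofReal Q.vol)⁻¹ * ∫⁻ x in Q.carrier, (ENNReal.ofReal (w x)) ^ q) *
      ((ENNReal.ofReal Q.vol)⁻¹ *
          ∫⁻ x in Q.carrier, (ENNReal.ofReal (w x)) ^ (-(p / (p - 1)))) ^ (q / (p / (p - 1)))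

/-- The testing constant `𝒯`. -/
def testT {n : ℕ} (p q r α : ℝ) (S : Set (Cube n)) (w σ' : (Fin n → ℝ) → ℝ) : ℝ≥0∞ :=
  ⨆ R ∈ S,
    wMass σ' R ^ (-(r / p)) *
      eNorm (q / r) w
        (cubeSum {Q | Q ∈ S ∧ Q.carrier ⊆ R.carrier}
          (fun Q => (ENNReal.ofReal Q.vol) ^ (-(α * r)) * wMass σ' Q ^ r))

/-- The testing constant `𝒯*`; here `1/(q/r)' = 1 - r/q` and `(p/r)' = (p/r)/((p/r)-1)`. -/
def testTstar {n : ℕ} (p q r α : ℝ) (S : Set (Cube n)) (w σ' : (Fin n → ℝ) → ℝ) : ℝ≥0∞ :=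
  ⨆ R ∈ S,
    wMass w R ^ (-(1 - r / q)) *
      eNorm ((p / r) / (p / r - 1)) σ'
        (cubeSum {Q | Q ∈ S ∧ Q.carrier ⊆ R.carrier}
          (fun Q => (ENNReal.ofReal Q.vol) ^ (-(α * r)) * wMass σ' Q ^ (r - 1) * wMass w Q))

/-- The operator (quasi)norm of `A^{r,α}_S(·σ) : L^p_σ → L^q_ω`, i.e. the least constant `K`
with `‖A^{r,α}_S(fσ)‖_{L^q_ω} ≤ K ‖f‖_{L^p_σ}` for all `f`. -/
def sparseOpNorm {n : ℕ} (p q r α : ℝ) (S : Set (Cube n)) (w σ' : (Fin n → ℝ) → ℝ) : ℝ≥0∞ :=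
  sInf {K : ℝ≥0∞ | ∀ f : (Fin n → ℝ) → ℝ, Measurable f →
    eNorm q w (sparseOp S r α (fun y => f y * σ' y)) ≤ K * wNorm p σ' f}

section RpowSums

variable {ι : Type*}

theorem add_rpow_le_rpow_add_mul (x y : ℝ≥0∞) {t : ℝ} (ht : 1 ≤ t) :
    (x + y) ^ t ≤ x ^ t + ENNReal.ofReal t * (y * (x + y) ^ (t - 1)) := by
  have ht0 : 0 < t := by linarith
  rcases eq_or_ne x ∞ with rfl | hx
  · simp [ENNReal.top_rpow_of_pos ht0]
  rcases eq_or_ne y ∞ with rfl | hy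
  · have h1 : (∞ : ℝ≥0∞) ^ (t - 1) ≠ 0 := by simp [ENNReal.rpow_eq_zero_iff]; linarith
    have h2 : ENNReal.ofReal t ≠ 0 := by simpa using ht0
    simp [ENNReal.top_mul h1, ENNReal.mul_top h2]
  rcases eq_or_ne (x + y) 0 with h0 | h0
  · rw [h0, ENNReal.zero_rpow_of_pos ht0]; exact zero_le
  lift x to NNReal using hx
  lift y to NNReal using hy
  have hz : (0 : ℝ) < x + y := by
    have : (0 : ℝ≥0∞) < ((x + y : NNReal) : ℝ≥0∞) := by
      rw [ENNReal.coe_add]; exact pos_iff_ne_zero.2 h0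
    exact_mod_cast this
  have key : ((x : ℝ) + y) ^ t ≤ (x : ℝ) ^ t + t * (y * ((x : ℝ) + y) ^ (t - 1)) := by
    have hb := one_add_mul_self_le_rpow_one_add (s := -((y : ℝ) / (x + y))) (p := t)
      (by rw [neg_le_neg_iff, div_le_one hz]; linarith [x.coe_nonneg]) ht
    have h1 : 1 + -((y : ℝ) / (x + y)) = x / (x + y) := by field_simp; ring
    rw [h1, Real.div_rpow x.coe_nonneg hz.le, le_div_iff₀ (Real.rpow_pos_of_pos hz t)] at hb
    have h2 : ((x : ℝ) + y) ^ t = ((x : ℝ) + y) ^ (t - 1) * (x + y) := by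
      rw [Real.rpow_sub_one hz.ne']; field_simp
    have h3 : (1 + t * -((y : ℝ) / (x + y))) * ((x : ℝ) + y) ^ t =
        ((x : ℝ) + y) ^ t - t * (y * ((x : ℝ) + y) ^ (t - 1)) := by
      rw [h2]; field_simp; ring
    linarith
  have e : ENNReal.ofReal t = ((t.toNNReal : NNReal) : ℝ≥0∞) := rfl
  rw [e, ← ENNReal.coe_add, ← ENNReal.coe_rpow_of_nonneg _ ht0.le, ← ENNReal.coe_rpow_of_nonneg _ ht0.le,
    ← ENNReal.coe_rpow_of_nonneg _ (sub_nonneg.2 ht), ← ENNReal.coe_mul, ← ENNReal.coe_mul,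
    ← ENNReal.coe_add, ENNReal.coe_le_coe, ← NNReal.coe_le_coe]
  push_cast
  rw [Real.coe_toNNReal t ht0.le]
  exact key

/-- Discrete summation by parts: a power of a sum is controlled by the powers of its partial
sums with respect to the preorder induced by `f`. -/
theorem sum_rpow_le_sum_mul_partial (s : Finset ι) (f : ι → ℝ) (l : ι → ℝ≥0∞) {t : ℝ}
    (ht : 1 ≤ t) :
    (∑ i ∈ s, l i) ^ t ≤
      ENNReal.ofReal t * ∑ i ∈ s, l i * (∑ j ∈ s with f j ≤ f i, l j) ^ (t - 1) := by
  classical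
  induction s using Finset.induction_on_max_value f with
  | empty => simp [ENNReal.zero_rpow_of_pos (show 0 < t by linarith)]
  | insert a s ha hmax ih =>
    have h1 : (insert a s).filter (fun j => f j ≤ f a) = insert a s := by
      apply Finset.filter_true_of_mem
      intro j hj
      rcases Finset.mem_insert.1 hj with rfl | hj
      · exact le_rfl
      · exact hmax j hj
    rw [Finset.sum_insert ha (f := fun i =>
      l i * (∑ j ∈ insert a s with f j ≤ f i, l j) ^ (t - 1)), h1, mul_add, Finset.sum_insert ha,
      add_comm (l a)]
    refine (add_rpow_le_rpow_add_mul _ _ ht).trans ?_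
    rw [add_comm]
    gcongr
    refine ih.trans ?_
    gcongr
    exact Finset.subset_insert a s

theorem sum_rpow_le_of_le_one (s : Finset ι) (l : ι → ℝ≥0∞) {t : ℝ} (ht : 0 < t) (ht1 : t ≤ 1) :
    (∑ i ∈ s, l i) ^ t ≤ ∑ i ∈ s, l i ^ t := by
  classical
  induction s using Finset.induction_on with
  | empty => simp [ht]
  | insert a s ha ih =>
    rw [Finset.sum_insert ha, Finset.sum_insert ha]
    exact (ENNReal.rpow_add_le_add_rpow _ _ ht.le ht1).trans (by gcongr)

theorem sum_rpow_mul_rpow_le (s : Finset ι) (x y : ι → ℝ≥0∞) {a b : ℝ} (ha : 0 ≤ a) (hb : 0 ≤ b)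
    (hab : a + b = 1) :
    ∑ i ∈ s, x i ^ a * y i ^ b ≤ (∑ i ∈ s, x i) ^ a * (∑ i ∈ s, y i) ^ b := by
  rcases ha.eq_or_lt with rfl | ha
  · obtain rfl : b = 1 := by linarith
    simp
  rcases hb.eq_or_lt with rfl | hb
  · obtain rfl : a = 1 := by linarith
    simp
  have hc : (a⁻¹).HolderConjugate b⁻¹ := by
    rw [Real.holderConjugate_iff]
    refine ⟨(one_lt_inv₀ ha).2 (by linarith), by simpa using hab⟩
  refine (ENNReal.inner_le_Lp_mul_Lq s (fun i => x i ^ a) (fun i => y i ^ b) hc).trans (le_of_eq ?_)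
  simp only [← ENNReal.rpow_mul, mul_inv_cancel₀ ha.ne', mul_inv_cancel₀ hb.ne', ENNReal.rpow_one,
    one_div, inv_inv]

end RpowSums

section NestedSums

variable {ι X : Type*} [MeasurableSpace X]

theorem setLIntegral_rpow_le (μ : Measure X) {C : Set X} (hμ : μ C ≠ ∞) {g : X → ℝ≥0∞}
    (hg : AEMeasurable g μ) {t : ℝ} (ht : 0 ≤ t) (ht1 : t ≤ 1) :
    ∫⁻ x in C, g x ^ t ∂μ ≤ μ C * ((μ C)⁻¹ * ∫⁻ x in C, g x ∂μ) ^ t := by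
  rcases eq_or_ne (μ C) 0 with h0 | h0
  · rw [Measure.restrict_eq_zero.2 h0]; simp
  have h := ENNReal.lintegral_mul_norm_pow_le (μ := μ.restrict C) (f := g) (g := fun _ => 1)
    hg.restrict aemeasurable_const ht (sub_nonneg.2 ht1) (by ring)
  simp only [ENNReal.one_rpow, mul_one, lintegral_const, Measure.restrict_apply_univ, one_mul] at h
  refine h.trans (le_of_eq ?_)
  rw [ENNReal.mul_rpow_of_nonneg _ _ ht, ← mul_assoc, mul_comm, ← ENNReal.rpow_neg_one,
    ← ENNReal.rpow_mul, sub_eq_add_neg, ENNReal.rpow_add _ _ h0 hμ, ENNReal.rpow_one]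
  ring_nf

/-- The pairwise nestedness of a finite family of sets at almost every point, the sets being
ranked by the size function `f`. -/
def AENested (μ : Measure X) (F : Finset ι) (C : ι → Set X) (f : ι → ℝ) : Prop :=
  ∀ᵐ x ∂μ, ∀ i ∈ F, ∀ j ∈ F, x ∈ C i → x ∈ C j → f j ≤ f i → C j ⊆ C i

variable {μ : Measure X} {F : Finset ι} {C : ι → Set X} {f : ι → ℝ} {l : ι → ℝ≥0∞}

theorem measurable_sum_indicator_const (F : Finset ι) (l : ι → ℝ≥0∞)
    (hC : ∀ i ∈ F, MeasurableSet (C i)) :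
    Measurable fun x => ∑ i ∈ F, (C i).indicator (fun _ => l i) x :=
  Finset.measurable_fun_sum _ fun i hi => measurable_const.indicator (hC i hi)

theorem lintegral_sum_indicator_const (F : Finset ι) (l : ι → ℝ≥0∞)
    (hC : ∀ i ∈ F, MeasurableSet (C i)) :
    ∫⁻ x, ∑ i ∈ F, (C i).indicator (fun _ => l i) x ∂μ = ∑ i ∈ F, l i * μ (C i) := by
  rw [lintegral_finsetSum' _ fun i hi => (measurable_const.indicator (hC i hi)).aemeasurable]
  exact Finset.sum_congr rfl fun i hi => lintegral_indicator_const (hC i hi) _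

open Classical in
/-- The average over `C i` of the part of the sum supported inside `C i`. -/
def localAverage (μ : Measure X) (F : Finset ι) (C : ι → Set X) (l : ι → ℝ≥0∞) (i : ι) : ℝ≥0∞ :=
  (μ (C i))⁻¹ * ∑ j ∈ F with C j ⊆ C i, l j * μ (C j)

open Classical in
theorem measure_mul_localAverage (hμ : ∀ i ∈ F, μ (C i) ≠ ∞) {i : ι} (hi : i ∈ F) :
    μ (C i) * localAverage μ F C l i = ∑ j ∈ F with C j ⊆ C i, l j * μ (C j) := by
  rw [localAverage, ← mul_assoc]
  rcases eq_or_ne (μ (C i)) 0 with h0 | h0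
  · rw [h0, zero_mul, zero_mul, eq_comm]
    refine Finset.sum_eq_zero fun j hj => ?_
    rw [measure_mono_null (Finset.mem_filter.1 hj).2 h0, mul_zero]
  · rw [ENNReal.mul_inv_cancel h0 (hμ i hi), one_mul]

open Classical in
theorem setLIntegral_local_sum (hC : ∀ i ∈ F, MeasurableSet (C i)) (i : ι) :
    ∫⁻ x in C i, ∑ j ∈ F with C j ⊆ C i, (C j).indicator (fun _ => l j) x ∂μ
      = ∑ j ∈ F with C j ⊆ C i, l j * μ (C j) := by
  rw [lintegral_sum_indicator_const _ _ fun j hj => hC j (Finset.mem_filter.1 hj).1]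
  refine Finset.sum_congr rfl fun j hj => ?_
  rw [Measure.restrict_eq_self _ (Finset.mem_filter.1 hj).2]

theorem lintegral_sum_rpow_le_of_le_two (hC : ∀ i ∈ F, MeasurableSet (C i))
    (hμ : ∀ i ∈ F, μ (C i) ≠ ∞) (hnest : AENested μ F C f) {s : ℝ} (hs : 1 < s) (hs2 : s ≤ 2) :
    ∫⁻ x, (∑ i ∈ F, (C i).indicator (fun _ => l i) x) ^ s ∂μ ≤
      ENNReal.ofReal s * ∑ i ∈ F, l i * (μ (C i) * localAverage μ F C l i ^ (s - 1)) := by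
  classical
  have hpt : ∀ᵐ x ∂μ, (∑ i ∈ F, (C i).indicator (fun _ => l i) x) ^ s ≤
      ENNReal.ofReal s * ∑ i ∈ F, (C i).indicator (fun x => l i *
        (∑ j ∈ F with C j ⊆ C i, (C j).indicator (fun _ => l j) x) ^ (s - 1)) x := by
    filter_upwards [hnest] with x hx
    refine (sum_rpow_le_sum_mul_partial F f _ hs.le).trans ?_
    gcongr with i hi
    by_cases hxi : x ∈ C i
    · rw [indicator_of_mem hxi, indicator_of_mem hxi]
      refine mul_le_mul' le_rfl (ENNReal.rpow_le_rpow ?_ (by linarith))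
      rw [Finset.sum_filter, Finset.sum_filter]
      gcongr with j hj
      by_cases hxj : x ∈ C j
      · by_cases hf : f j ≤ f i
        · rw [if_pos hf, if_pos (hx i hi j hj hxi hxj hf)]
        · simp [hf]
      · simp [hxj]
    · simp [hxi]
  have hm : ∀ i ∈ F, Measurable fun x =>
      ∑ j ∈ F with C j ⊆ C i, (C j).indicator (fun _ => l j) x := fun i _ =>
    measurable_sum_indicator_const _ _ fun j hj => hC j (Finset.mem_filter.1 hj).1
  refine (lintegral_mono_ae hpt).trans ?_
  rw [lintegral_const_mul' _ _ ENNReal.ofReal_ne_top, lintegral_finsetSum' _ fun i hi =>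
    (((hm i hi).pow_const _).const_mul _ |>.indicator (hC i hi)).aemeasurable]
  gcongr with i hi
  rw [lintegral_indicator (hC i hi), lintegral_const_mul _ ((hm i hi).pow_const _)]
  gcongr
  refine (setLIntegral_rpow_le μ (hμ i hi) (hm i hi).aemeasurable (by linarith)
    (by linarith)).trans ?_
  rw [setLIntegral_local_sum hC, localAverage]

theorem lintegral_sum_rpow_le_of_two_lt (hC : ∀ i ∈ F, MeasurableSet (C i))
    (hμ : ∀ i ∈ F, μ (C i) ≠ ∞) (hl : ∀ i ∈ F, l i ≠ ∞) (hnest : AENested μ F C f)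
    {s : ℝ} (hs : 2 < s) :
    ∫⁻ x, (∑ i ∈ F, (C i).indicator (fun _ => l i) x) ^ s ∂μ ≤
      (ENNReal.ofReal s * ENNReal.ofReal (s - 1)) ^ (s - 1) *
        ∑ i ∈ F, l i * (μ (C i) * localAverage μ F C l i ^ (s - 1)) := by
  classical
  set T := ∫⁻ x, (∑ i ∈ F, (C i).indicator (fun _ => l i) x) ^ s ∂μ with hT
  set W := ∑ i ∈ F, l i * (μ (C i) * localAverage μ F C l i ^ (s - 1)) with hW
  set K := ENNReal.ofReal s * ENNReal.ofReal (s - 1) with hK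
  let G : ι → ℝ≥0∞ := fun i => ∑ j ∈ F with C i ⊆ C j, l j
  have hTfin : T ≠ ∞ := by
    have hle : ∀ x, (∑ i ∈ F, (C i).indicator (fun _ => l i) x) ^ s ≤
        (⋃ i ∈ F, C i).indicator (fun _ => (∑ i ∈ F, l i) ^ s) x := by
      intro x
      by_cases hx : x ∈ ⋃ i ∈ F, C i
      · rw [indicator_of_mem hx]
        gcongr with i hi
        exact indicator_le_self' (fun _ _ => zero_le) x
      · rw [indicator_of_notMem hx, Finset.sum_eq_zero, ENNReal.zero_rpow_of_pos (by linarith)]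
        intro i hi
        refine indicator_of_notMem (fun h => hx ?_) _
        exact mem_biUnion hi h
    refine ne_top_of_le_ne_top ?_ (lintegral_mono hle)
    rw [lintegral_indicator_const (Finset.measurableSet_biUnion _ hC)]
    refine ENNReal.mul_ne_top (ENNReal.rpow_ne_top_of_nonneg (by linarith)
      (ENNReal.sum_ne_top.2 hl)) ?_
    refine ne_top_of_le_ne_top ?_ (measure_biUnion_finset_le F C)
    exact ENNReal.sum_ne_top.2 hμ
  have hpt : ∀ᵐ x ∂μ, (∑ i ∈ F, (C i).indicator (fun _ => l i) x) ^ s ≤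
      K * ∑ j ∈ F, (C j).indicator (fun x => l j * G j ^ (s - 2) *
        (∑ i ∈ F with C i ⊆ C j, (C i).indicator (fun _ => l i) x)) x := by
    filter_upwards [hnest] with x hx
    set L : ι → ℝ≥0∞ := fun i => (C i).indicator (fun _ => l i) x with hL
    set H : ι → ℝ≥0∞ := fun i => ∑ j ∈ F with f i ≤ f j, L j with hH
    have h1 : (∑ i ∈ F, L i) ^ s ≤ ENNReal.ofReal s * ∑ i ∈ F, L i * H i ^ (s - 1) := by
      have := sum_rpow_le_sum_mul_partial F (fun i => - f i) L (t := s) (by linarith)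
      simpa only [neg_le_neg_iff] using this
    have h2 : ∀ i ∈ F, H i ^ (s - 1) ≤ ENNReal.ofReal (s - 1) *
        ∑ j ∈ F with f i ≤ f j, L j * H j ^ (s - 2) := by
      intro i hi
      refine (sum_rpow_le_sum_mul_partial {j ∈ F | f i ≤ f j} (fun i => - f i) L (t := s - 1)
        (by linarith)).trans ?_
      gcongr with j hj
      have e : s - 1 - 1 = s - 2 := by ring
      simp only [neg_le_neg_iff, e]
      refine ENNReal.rpow_le_rpow (Finset.sum_le_sum_of_subset ?_) (by linarith)
      exact Finset.filter_subset_filter _ (Finset.filter_subset _ _)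
    calc (∑ i ∈ F, L i) ^ s ≤ ENNReal.ofReal s * ∑ i ∈ F, L i * H i ^ (s - 1) := h1
      _ ≤ ENNReal.ofReal s * ∑ i ∈ F, L i * (ENNReal.ofReal (s - 1) *
            ∑ j ∈ F with f i ≤ f j, L j * H j ^ (s - 2)) := by
          gcongr with i hi
          exact h2 i hi
      _ = K * ∑ j ∈ F, L j * H j ^ (s - 2) * ∑ i ∈ F with f i ≤ f j, L i := by
          simp only [Finset.sum_filter, Finset.mul_sum]
          rw [Finset.sum_comm]
          refine Finset.sum_congr rfl fun j _ => Finset.sum_congr rfl fun i _ => ?_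
          split_ifs
          · rw [hK]; ring
          · simp
      _ ≤ _ := by
          gcongr with j hj
          by_cases hxj : x ∈ C j
          · rw [indicator_of_mem hxj]
            have hLj : L j = l j := indicator_of_mem hxj _
            rw [hLj]
            refine mul_le_mul' (mul_le_mul' le_rfl (ENNReal.rpow_le_rpow ?_ (by linarith))) ?_
            · simp only [hH, G, Finset.sum_filter]
              gcongr with i hi
              by_cases hxi : x ∈ C i
              · by_cases hf : f j ≤ f i
                · rw [if_pos hf, if_pos (hx i hi j hj hxi hxj hf)]
                  exact indicator_le_self' (fun _ _ => zero_le) x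
                · simp [hf]
              · simp [hL, hxi]
            · simp only [Finset.sum_filter]
              gcongr with i hi
              by_cases hxi : x ∈ C i
              · by_cases hf : f i ≤ f j
                · rw [if_pos hf, if_pos (hx j hj i hi hxj hxi hf)]
                · simp [hf]
              · simp [hL, hxi]
          · simp [hL, hxj]
  have hm : ∀ j ∈ F, Measurable fun x =>
      ∑ i ∈ F with C i ⊆ C j, (C i).indicator (fun _ => l i) x := fun i _ =>
    measurable_sum_indicator_const _ _ fun j hj => hC j (Finset.mem_filter.1 hj).1
  have hTK : T ≤ K * ∑ j ∈ F, l j * G j ^ (s - 2) * (μ (C j) * localAverage μ F C l j) := by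
    refine (lintegral_mono_ae hpt).trans ?_
    rw [lintegral_const_mul' _ _ (ENNReal.mul_ne_top ENNReal.ofReal_ne_top ENNReal.ofReal_ne_top),
      lintegral_finsetSum' _ fun i hi =>
        ((hm i hi).const_mul _ |>.indicator (hC i hi)).aemeasurable]
    gcongr with i hi
    rw [lintegral_indicator (hC i hi), lintegral_const_mul _ (hm i hi),
      setLIntegral_local_sum hC, measure_mul_localAverage hμ hi]
  have hGT : ∑ j ∈ F, l j * (μ (C j) * G j ^ (s - 1)) ≤ T := by
    have : ∑ j ∈ F, l j * (μ (C j) * G j ^ (s - 1)) =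
        ∫⁻ x, ∑ j ∈ F, (C j).indicator (fun _ => l j * G j ^ (s - 1)) x ∂μ := by
      rw [lintegral_sum_indicator_const _ _ hC]
      exact Finset.sum_congr rfl fun j _ => by ring
    rw [this, hT]
    refine lintegral_mono fun x => ?_
    have e : (s : ℝ) = 1 + (s - 1) := by ring
    conv_rhs => rw [e, ENNReal.rpow_add_of_nonneg _ _ zero_le_one (by linarith), ENNReal.rpow_one,
      Finset.sum_mul]
    gcongr with j hj
    by_cases hxj : x ∈ C j
    · rw [indicator_of_mem hxj, indicator_of_mem hxj]
      gcongr
      · linarith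
      simp only [G, Finset.sum_filter]
      gcongr with i hi
      split_ifs with h
      · rw [indicator_of_mem (h hxj)]
      · exact zero_le
    · simp [hxj]
  have hs1 : (0 : ℝ) < s - 1 := by linarith
  have hTh : T ≤ K * (T ^ ((s - 2) / (s - 1)) * W ^ (1 / (s - 1))) := by
    refine hTK.trans ?_
    gcongr
    have hsum : (s - 2) / (s - 1) + 1 / (s - 1) = 1 := by field_simp; ring
    have hp0 : 0 ≤ (s - 2) / (s - 1) := by apply div_nonneg <;> linarith
    have hq0 : 0 ≤ 1 / (s - 1) := by positivity
    refine le_trans ?_ ((sum_rpow_mul_rpow_le F (fun j => l j * (μ (C j) * G j ^ (s - 1)))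
      (fun j => l j * (μ (C j) * localAverage μ F C l j ^ (s - 1))) hp0 hq0 hsum).trans
      (by gcongr))
    refine Finset.sum_le_sum fun j _ => le_of_eq ?_
    have e1 : (G j ^ (s - 1)) ^ ((s - 2) / (s - 1)) = G j ^ (s - 2) := by
      rw [← ENNReal.rpow_mul]; congr 1; field_simp
    have e2 : (localAverage μ F C l j ^ (s - 1)) ^ (1 / (s - 1)) = localAverage μ F C l j := by
      rw [← ENNReal.rpow_mul, mul_one_div_cancel hs1.ne', ENNReal.rpow_one]
    have e3 : ∀ z : ℝ≥0∞, z = z ^ ((s - 2) / (s - 1)) * z ^ (1 / (s - 1)) := fun z => by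
      rw [← ENNReal.rpow_add_of_nonneg _ _ hp0 hq0, hsum, ENNReal.rpow_one]
    rw [ENNReal.mul_rpow_of_nonneg _ _ hp0, ENNReal.mul_rpow_of_nonneg _ _ hp0,
      ENNReal.mul_rpow_of_nonneg _ _ hq0, ENNReal.mul_rpow_of_nonneg _ _ hq0, e1, e2]
    nth_rewrite 1 [e3 (l j), e3 (μ (C j))]
    ring
  rcases eq_or_ne T 0 with h0 | h0
  · rw [h0]; exact zero_le
  have hT1 : T ^ (1 / (s - 1)) ≤ K * W ^ (1 / (s - 1)) := by
    have hne : T ^ ((s - 2) / (s - 1)) ≠ 0 := by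
      simp [ENNReal.rpow_eq_zero_iff, h0, hTfin]
    have hnt : T ^ ((s - 2) / (s - 1)) ≠ ∞ := by
      apply ENNReal.rpow_ne_top_of_nonneg _ hTfin
      apply div_nonneg <;> linarith
    rw [← ENNReal.mul_le_mul_iff_right hne hnt, ← ENNReal.rpow_add _ _ h0 hTfin]
    have : (s - 2) / (s - 1) + 1 / (s - 1) = 1 := by field_simp; ring
    rw [this, ENNReal.rpow_one]
    exact hTh.trans_eq (by ring)
  have := ENNReal.rpow_le_rpow hT1 hs1.le
  rwa [ENNReal.mul_rpow_of_nonneg _ _ hs1.le, ← ENNReal.rpow_mul, ← ENNReal.rpow_mul,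
    one_div_mul_cancel hs1.ne', ENNReal.rpow_one, ENNReal.rpow_one] at this

/-- The constant in the estimate of the `L^s` norm of a sum over nested sets. -/
def nestedConst (s : ℝ) : ℝ≥0∞ :=
  ENNReal.ofReal s + (ENNReal.ofReal s * ENNReal.ofReal (s - 1)) ^ (s - 1)

theorem nestedConst_ne_top {s : ℝ} (hs : 1 < s) : nestedConst s ≠ ∞ := by
  refine ENNReal.add_ne_top.2 ⟨ENNReal.ofReal_ne_top, ENNReal.rpow_ne_top_of_nonneg
    (by linarith) (ENNReal.mul_ne_top ENNReal.ofReal_ne_top ENNReal.ofReal_ne_top)⟩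

/-- The `L^s` norm of a sum over nested sets is controlled by its local averages. -/
theorem lintegral_sum_rpow_le (hC : ∀ i ∈ F, MeasurableSet (C i))
    (hμ : ∀ i ∈ F, μ (C i) ≠ ∞) (hl : ∀ i ∈ F, l i ≠ ∞) (hnest : AENested μ F C f)
    {s : ℝ} (hs : 1 < s) :
    ∫⁻ x, (∑ i ∈ F, (C i).indicator (fun _ => l i) x) ^ s ∂μ ≤
      nestedConst s * ∑ i ∈ F, l i * (μ (C i) * localAverage μ F C l i ^ (s - 1)) := by
  rcases le_or_gt s 2 with h | h
  · refine (lintegral_sum_rpow_le_of_le_two hC hμ hnest hs h).trans ?_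
    gcongr
    exact le_self_add
  · refine (lintegral_sum_rpow_le_of_two_lt hC hμ hl hnest h).trans ?_
    gcongr
    exact le_add_self

end NestedSums

section DyadicGeometry

variable {n : ℕ}

namespace Cube

theorem carrier_eq_Icc (Q : Cube n) : Q.carrier = Icc Q.corner fun i => Q.corner i + Q.side := by
  ext x
  simp only [carrier, mem_ofPred_eq, mem_Icc, Pi.le_def, forall_and]

theorem measurableSet_carrier (Q : Cube n) : MeasurableSet Q.carrier := by
  rw [carrier_eq_Icc]
  exact measurableSet_Icc

theorem vol_pos (Q : Cube n) : 0 < Q.vol := pow_pos Q.side_pos n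

theorem volume_carrier (Q : Cube n) : volume Q.carrier = ENNReal.ofReal Q.vol := by
  rw [carrier_eq_Icc, Real.volume_Icc_pi, vol, ENNReal.ofReal_pow Q.side_pos.le]
  simp

/-- Of two dyadic cubes the smaller one is contained in the larger one, unless their
intersection is negligible. -/
theorem IsDyadic.subset_or_volume_inter_eq_zero {Q Q' : Cube n} (hQ : Q.IsDyadic)
    (hQ' : Q'.IsDyadic) (hside : Q'.side ≤ Q.side) :
    Q'.carrier ⊆ Q.carrier ∨ volume (Q.carrier ∩ Q'.carrier) = 0 := by
  obtain ⟨j, m, hs, hc⟩ := hQ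
  obtain ⟨j', m', hs', hc'⟩ := hQ'
  have hj : j ≤ j' := by
    rw [hs, hs'] at hside
    have := (zpow_le_zpow_iff_right₀ (by norm_num : (1 : ℝ) < 2)).1 hside
    omega
  obtain ⟨N, rfl⟩ : ∃ N : ℕ, j' = j + N := ⟨(j' - j).toNat, by omega⟩
  set d : ℝ := (2 : ℝ) ^ (-(j + N : ℤ)) with hd
  have hd0 : 0 < d := by positivity
  have h2 : (2 : ℝ) ^ (-j) = 2 ^ N * d := by
    rw [hd, ← zpow_natCast, ← zpow_add₀ (by norm_num)]
    congr 1
    ring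
  by_cases h : ∀ i, m i * 2 ^ N ≤ m' i ∧ m' i + 1 ≤ (m i + 1) * 2 ^ N
  · left
    intro x hx i
    obtain ⟨h3, h4⟩ := h i
    have h3' : (m i * 2 ^ N : ℝ) ≤ m' i := by exact_mod_cast h3
    have h4' : (m' i + 1 : ℝ) ≤ (m i + 1) * 2 ^ N := by exact_mod_cast h4
    obtain ⟨h5, h6⟩ := hx i
    rw [hc'] at h5 h6
    rw [hs'] at h6
    rw [hc, hs, h2]
    constructor <;> nlinarith
  · right
    push Not at h
    obtain ⟨i, hi⟩ := h
    rw [carrier_eq_Icc, carrier_eq_Icc, Icc_inter_Icc, Real.volume_Icc_pi]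
    refine Finset.prod_eq_zero (Finset.mem_univ i) ?_
    rw [ENNReal.ofReal_eq_zero, Pi.sup_apply, Pi.inf_apply, hc, hc', hs, hs', h2]
    rcases lt_or_ge (m' i) (m i * 2 ^ N) with h3 | h3
    · have h4 : (m' i + 1 : ℝ) ≤ m i * 2 ^ N := by exact_mod_cast h3
      have := min_le_right (↑(m i) * (2 ^ N * d) + 2 ^ N * d) (↑(m' i) * d + d)
      have := le_max_left (↑(m i) * (2 ^ N * d)) (↑(m' i) * d)
      nlinarith
    · have h4 : ((m i + 1) * 2 ^ N : ℝ) ≤ m' i := by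
        have := hi h3
        exact_mod_cast (by omega : (m i + 1) * 2 ^ N ≤ m' i)
      have := min_le_left (↑(m i) * (2 ^ N * d) + 2 ^ N * d) (↑(m' i) * d + d)
      have := le_max_right (↑(m i) * (2 ^ N * d)) (↑(m' i) * d)
      nlinarith

end Cube

theorem aeNested_of_isDyadic {μ : Measure (Fin n → ℝ)} (hμ : μ ≪ volume) {F : Finset (Cube n)}
    (hF : ∀ Q ∈ F, Q.IsDyadic) : AENested μ F Cube.carrier Cube.side := by
  rw [AENested, Finset.eventually_all]
  intro Q hQ
  rw [Finset.eventually_all]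
  intro Q' hQ'
  by_cases hside : Q'.side ≤ Q.side
  · rcases (hF Q hQ).subset_or_volume_inter_eq_zero (hF Q' hQ') hside with h | h
    · exact Filter.Eventually.of_forall fun _ _ _ _ => h
    · filter_upwards [measure_eq_zero_iff_ae_notMem.1 (hμ h)] with x hx hxQ hxQ'
      exact absurd ⟨hxQ, hxQ'⟩ hx
  · exact Filter.Eventually.of_forall fun _ _ _ h => absurd h hside

/-- If `ν` has density at least `t` on each of finitely many dyadic cubes, then so it has on their
union. -/
theorem mul_volume_biUnion_le {ν : Measure (Fin n → ℝ)} (hν : ν ≪ volume) {t : ℝ≥0∞}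
    (G : Finset (Cube n)) (hG : ∀ Q ∈ G, Q.IsDyadic)
    (ht : ∀ Q ∈ G, t * volume Q.carrier ≤ ν Q.carrier) :
    t * volume (⋃ Q ∈ G, Q.carrier) ≤ ν (⋃ Q ∈ G, Q.carrier) := by
  classical
  induction G using Finset.induction_on_min_value (Cube.side (n := n)) with
  | empty => simp
  | insert a G ha hmin ih =>
    have ih' := ih (fun Q hQ => hG Q (Finset.mem_insert_of_mem hQ))
      fun Q hQ => ht Q (Finset.mem_insert_of_mem hQ)
    rw [Finset.set_biUnion_insert]
    by_cases hsub : ∃ Q ∈ G, a.carrier ⊆ Q.carrier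
    · obtain ⟨Q, hQ, hs⟩ := hsub
      rwa [union_eq_right.2 (hs.trans (subset_iUnion₂_of_subset Q hQ subset_rfl))]
    · push Not at hsub
      have hd : volume (a.carrier ∩ ⋃ Q ∈ G, Q.carrier) = 0 := by
        rw [inter_iUnion₂]
        refine (measure_biUnion_null_iff G.countable_toSet).2 ?_
        intro Q hQ
        rw [inter_comm]
        exact ((hG Q (Finset.mem_insert_of_mem hQ)).subset_or_volume_inter_eq_zero
          (hG a (Finset.mem_insert_self a G)) (hmin Q hQ)).resolve_left (hsub Q hQ)
      have hm : MeasurableSet (⋃ Q ∈ G, Q.carrier) :=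
        Finset.measurableSet_biUnion _ fun Q _ => Q.measurableSet_carrier
      have hd' : AEDisjoint ν a.carrier (⋃ Q ∈ G, Q.carrier) := hν hd
      rw [measure_union₀ hm.nullMeasurableSet hd', mul_comm]
      refine (mul_le_mul_left (measure_union_le _ _) _).trans ?_
      rw [add_mul, mul_comm _ t, mul_comm _ t]
      exact add_le_add (ht a (Finset.mem_insert_self a G)) ih'

end DyadicGeometry

section Sparse

variable {n : ℕ} {η : ℝ} {S : Set (Cube n)}

/-- Carleson packing of the Lebesgue measure over a sparse family, in the form of an integral
inequality. -/
theorem IsSparse.sum_le_lintegral (hS : IsSparse η S) (hη : 0 < η) {F : Finset (Cube n)}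
    (hF : ∀ Q ∈ F, Q ∈ S) {U : Set (Fin n → ℝ)} (hU : ∀ Q ∈ F, Q.carrier ⊆ U)
    (g : (Fin n → ℝ) → ℝ≥0∞) (c : Cube n → ℝ≥0∞) (hc : ∀ Q ∈ F, ∀ x ∈ Q.carrier, c Q ≤ g x) :
    ∑ Q ∈ F, c Q * ENNReal.ofReal Q.vol ≤ (ENNReal.ofReal η)⁻¹ * ∫⁻ x in U, g x := by
  obtain ⟨E, hEm, hEQ, hEd, hEv⟩ := hS
  have h0 : ENNReal.ofReal η ≠ 0 := by simpa using hη
  rw [← ENNReal.mul_le_iff_le_inv h0 ENNReal.ofReal_ne_top, Finset.mul_sum]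
  calc ∑ Q ∈ F, ENNReal.ofReal η * (c Q * ENNReal.ofReal Q.vol)
      ≤ ∑ Q ∈ F, ∫⁻ x in E Q, g x := by
        refine Finset.sum_le_sum fun Q hQ => ?_
        calc ENNReal.ofReal η * (c Q * ENNReal.ofReal Q.vol)
            = c Q * ENNReal.ofReal (η * Q.vol) := by
              rw [ENNReal.ofReal_mul hη.le]; ring
          _ ≤ c Q * volume (E Q) := by gcongr; exact hEv Q (hF Q hQ)
          _ = ∫⁻ x in E Q, c Q := by simp
          _ ≤ ∫⁻ x in E Q, g x := setLIntegral_mono' (hEm Q (hF Q hQ)) fun x hx =>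
              hc Q hQ x (hEQ Q (hF Q hQ) hx)
    _ = ∫⁻ x in ⋃ Q ∈ F, E Q, g x := by
        rw [lintegral_biUnion_finset _ fun Q hQ => hEm Q (hF Q hQ)]
        intro Q hQ Q' hQ' hne
        exact hEd (hF Q hQ) (hF Q' hQ') hne
    _ ≤ ∫⁻ x in U, g x := lintegral_mono_set
        (iUnion₂_subset fun Q hQ => (hEQ Q (hF Q hQ)).trans (hU Q hQ))

theorem IsSparse.sum_vol_le (hS : IsSparse η S) (hη : 0 < η) {F : Finset (Cube n)}
    (hF : ∀ Q ∈ F, Q ∈ S) {U : Set (Fin n → ℝ)} (hU : ∀ Q ∈ F, Q.carrier ⊆ U) :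
    ∑ Q ∈ F, ENNReal.ofReal Q.vol ≤ (ENNReal.ofReal η)⁻¹ * volume U := by
  simpa using hS.sum_le_lintegral hη hF hU (fun _ => 1) (fun _ => 1) fun _ _ _ _ => le_rfl

theorem exists_pow_two_near {x : ℝ≥0∞} (hx : 1 ≤ x) (hx' : x ≠ ∞) :
    ∃ k : ℕ, 2 ^ k ≤ x ∧ x ≤ 2 ^ (k + 1) := by
  lift x to NNReal using hx'
  obtain ⟨k, h1, h2⟩ := exists_nat_pow_near (x := x) (y := 2) (by exact_mod_cast hx) one_lt_two
  exact ⟨k, by exact_mod_cast h1, by exact_mod_cast h2.le⟩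

/-- The constant in Kolmogorov's inequality for sparse families. -/
def kolmogorovConst (η γ : ℝ) : ℝ≥0∞ :=
  (ENNReal.ofReal η)⁻¹ * (1 + 2 ^ γ * (1 - 2 ^ γ * 2⁻¹)⁻¹)

theorem kolmogorovConst_ne_top (hη : 0 < η) {γ : ℝ} (hγ1 : γ < 1) :
    kolmogorovConst η γ ≠ ∞ := by
  have h1 : (2 : ℝ≥0∞) ^ γ * 2⁻¹ < 1 := by
    rw [← ENNReal.rpow_neg_one, ← ENNReal.rpow_add _ _ two_ne_zero ENNReal.ofNat_ne_top]
    exact ENNReal.rpow_lt_one_of_one_lt_of_neg (by norm_num) (by linarith)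
  have h2 : (2 : ℝ≥0∞) ^ γ ≠ ∞ := by simp [ENNReal.rpow_eq_top_iff]
  refine ENNReal.mul_ne_top (by simpa using hη) (ENNReal.add_ne_top.2 ⟨by simp,
    ENNReal.mul_ne_top h2 ?_⟩)
  rw [ENNReal.inv_ne_top]
  exact (tsub_pos_of_lt h1).ne'

/-- Kolmogorov's inequality for a sparse family of dyadic cubes. -/
theorem IsSparse.sum_vol_rpow_mul_rpow_le (hS : IsSparse η S) (hη : 0 < η)
    (hdy : ∀ Q ∈ S, Q.IsDyadic) {ν : Measure (Fin n → ℝ)} (hν : ν ≪ volume)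
    {F : Finset (Cube n)} (hF : ∀ Q ∈ F, Q ∈ S) {R : Cube n} (hR : ν R.carrier ≠ ∞)
    (hFR : ∀ Q ∈ F, Q.carrier ⊆ R.carrier) {γ : ℝ} (hγ : 0 < γ) :
    ∑ Q ∈ F, ENNReal.ofReal Q.vol ^ (1 - γ) * ν Q.carrier ^ γ ≤
      kolmogorovConst η γ * (ENNReal.ofReal R.vol ^ (1 - γ) * ν R.carrier ^ γ) := by
  classical
  rcases eq_or_ne (ν R.carrier) 0 with h0 | h0
  · rw [Finset.sum_eq_zero]
    · exact zero_le
    · intro Q hQ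
      rw [measure_mono_null (hFR Q hQ) h0, ENNReal.zero_rpow_of_pos hγ, mul_zero]
  have hv0 : ∀ Q : Cube n, ENNReal.ofReal Q.vol ≠ 0 := fun Q => by simpa using Q.vol_pos
  have hv : ∀ Q : Cube n, ENNReal.ofReal Q.vol ≠ ∞ := fun Q => ENNReal.ofReal_ne_top
  set D := ν R.carrier / ENNReal.ofReal R.vol with hD
  have hD0 : D ≠ 0 := ENNReal.div_ne_zero.2 ⟨h0, hv R⟩
  have hDt : D ≠ ∞ := ENNReal.div_ne_top hR (hv0 R)
  have hDR : D * ENNReal.ofReal R.vol = ν R.carrier := ENNReal.div_mul_cancel (hv0 R) (hv R)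
  have hsplit : ∀ Q : Cube n, ∀ c : ℝ≥0∞,
      ENNReal.ofReal Q.vol ^ (1 - γ) * (c * ENNReal.ofReal Q.vol) ^ γ =
        c ^ γ * ENNReal.ofReal Q.vol := fun Q c => by
    rw [ENNReal.mul_rpow_of_nonneg _ _ hγ.le, mul_left_comm, ← ENNReal.rpow_add _ _ (hv0 Q) (hv Q)]
    simp
  have hterm : ∀ Q ∈ F, ENNReal.ofReal Q.vol ^ (1 - γ) * ν Q.carrier ^ γ ≤
      D ^ γ * (ENNReal.ofReal Q.vol + ∑' k : ℕ, (2 ^ γ) ^ (k + 1) *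
        if 2 ^ k * D * ENNReal.ofReal Q.vol ≤ ν Q.carrier then ENNReal.ofReal Q.vol else 0) := by
    intro Q hQ
    rcases le_total (ν Q.carrier) (D * ENNReal.ofReal Q.vol) with h | h
    · calc _ ≤ ENNReal.ofReal Q.vol ^ (1 - γ) * (D * ENNReal.ofReal Q.vol) ^ γ := by gcongr
        _ = D ^ γ * ENNReal.ofReal Q.vol := hsplit Q D
        _ ≤ _ := by gcongr; exact le_self_add
    · have hDv0 : D * ENNReal.ofReal Q.vol ≠ 0 := mul_ne_zero hD0 (hv0 Q)
      have hDvt : D * ENNReal.ofReal Q.vol ≠ ∞ := ENNReal.mul_ne_top hDt (hv Q)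
      have hQt : ν Q.carrier ≠ ∞ := measure_ne_top_of_subset (hFR Q hQ) hR
      obtain ⟨k, hk1, hk2⟩ := exists_pow_two_near (x := ν Q.carrier / (D * ENNReal.ofReal Q.vol))
        ((ENNReal.le_div_iff_mul_le (Or.inl hDv0) (Or.inl hDvt)).2 (by rwa [one_mul]))
        (ENNReal.div_ne_top hQt hDv0)
      rw [ENNReal.le_div_iff_mul_le (Or.inl hDv0) (Or.inl hDvt), ← mul_assoc] at hk1
      rw [ENNReal.div_le_iff hDv0 hDvt, ← mul_assoc] at hk2
      calc _ ≤ ENNReal.ofReal Q.vol ^ (1 - γ) * (2 ^ (k + 1) * D * ENNReal.ofReal Q.vol) ^ γ := by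
              gcongr
        _ = D ^ γ * ((2 ^ γ) ^ (k + 1) * ENNReal.ofReal Q.vol) := by
              have e : ((2 : ℝ≥0∞) ^ (k + 1)) ^ γ = (2 ^ γ) ^ (k + 1) := by
                rw [← ENNReal.rpow_natCast, ← ENNReal.rpow_natCast, ← ENNReal.rpow_mul,
                  ← ENNReal.rpow_mul, mul_comm]
              rw [hsplit, ENNReal.mul_rpow_of_nonneg _ _ hγ.le, e]
              ring
        _ ≤ _ := by
              gcongr
              refine le_trans ?_ le_add_self
              refine le_trans ?_ (ENNReal.le_tsum k)
              rw [if_pos hk1]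
  have hlevel : ∀ k : ℕ, (∑ Q ∈ F, if 2 ^ k * D * ENNReal.ofReal Q.vol ≤ ν Q.carrier then
      ENNReal.ofReal Q.vol else 0) ≤ (ENNReal.ofReal η)⁻¹ * ENNReal.ofReal R.vol * 2⁻¹ ^ k := by
    intro k
    rw [← Finset.sum_filter]
    set G := {Q ∈ F | 2 ^ k * D * ENNReal.ofReal Q.vol ≤ ν Q.carrier} with hG
    have hGF : ∀ Q ∈ G, Q ∈ F := fun Q hQ => (Finset.mem_filter.1 hQ).1
    refine (hS.sum_vol_le hη (U := ⋃ Q ∈ G, Q.carrier) (fun Q hQ => hF Q (hGF Q hQ))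
      fun Q hQ => subset_biUnion_of_mem (u := Cube.carrier) hQ).trans ?_
    rw [mul_assoc]
    gcongr
    have h1 := mul_volume_biUnion_le hν (t := 2 ^ k * D) G (fun Q hQ => hdy Q (hF Q (hGF Q hQ)))
      (fun Q hQ => by rw [Q.volume_carrier]; exact (Finset.mem_filter.1 hQ).2)
    have h2 : ν (⋃ Q ∈ G, Q.carrier) ≤ D * ENNReal.ofReal R.vol := by
      rw [hDR]
      exact measure_mono (iUnion₂_subset fun Q hQ => hFR Q (hGF Q hQ))
    have h3 := h1.trans h2
    have h4 : 2 ^ k * volume (⋃ Q ∈ G, Q.carrier) ≤ ENNReal.ofReal R.vol := by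
      rw [← ENNReal.mul_le_mul_iff_right hD0 hDt]
      calc _ = 2 ^ k * D * volume (⋃ Q ∈ G, Q.carrier) := by ring
        _ ≤ _ := h3
    rw [← ENNReal.inv_pow, mul_comm, ← ENNReal.mul_le_iff_le_inv (by simp) (by simp)]
    exact h4
  calc ∑ Q ∈ F, ENNReal.ofReal Q.vol ^ (1 - γ) * ν Q.carrier ^ γ
      ≤ ∑ Q ∈ F, D ^ γ * (ENNReal.ofReal Q.vol + ∑' k : ℕ, (2 ^ γ) ^ (k + 1) *
        if 2 ^ k * D * ENNReal.ofReal Q.vol ≤ ν Q.carrier then ENNReal.ofReal Q.vol else 0) :=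
        Finset.sum_le_sum hterm
    _ = D ^ γ * (∑ Q ∈ F, ENNReal.ofReal Q.vol + ∑' k : ℕ, (2 ^ γ) ^ (k + 1) * ∑ Q ∈ F,
        if 2 ^ k * D * ENNReal.ofReal Q.vol ≤ ν Q.carrier then ENNReal.ofReal Q.vol else 0) := by
        rw [← Finset.mul_sum, Finset.sum_add_distrib,
          ← Summable.tsum_finsetSum fun _ _ => ENNReal.summable]
        simp only [Finset.mul_sum]
    _ ≤ D ^ γ * ((ENNReal.ofReal η)⁻¹ * ENNReal.ofReal R.vol + ∑' k : ℕ, (2 ^ γ) ^ (k + 1) *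
        ((ENNReal.ofReal η)⁻¹ * ENNReal.ofReal R.vol * 2⁻¹ ^ k)) := by
        gcongr with k
        · rw [← R.volume_carrier]
          exact hS.sum_vol_le hη hF hFR
        · exact hlevel k
    _ = kolmogorovConst η γ * (D ^ γ * ENNReal.ofReal R.vol) := by
        have e : ∀ k : ℕ, ((2 : ℝ≥0∞) ^ γ) ^ (k + 1) *
            ((ENNReal.ofReal η)⁻¹ * ENNReal.ofReal R.vol * 2⁻¹ ^ k) =
            ((ENNReal.ofReal η)⁻¹ * ENNReal.ofReal R.vol * 2 ^ γ) * (2 ^ γ * 2⁻¹) ^ k :=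
          fun k => by ring
        simp only [e]
        rw [ENNReal.tsum_mul_left, ENNReal.tsum_geometric, kolmogorovConst]
        ring
    _ = _ := by rw [← hsplit, hDR]

end Sparse

section Weights

variable {n : ℕ}

/-- The measure with density `w`. -/
def weightMeasure (w : (Fin n → ℝ) → ℝ) : Measure (Fin n → ℝ) :=
  volume.withDensity fun x => ENNReal.ofReal (w x)

theorem weightMeasure_absolutelyContinuous (w : (Fin n → ℝ) → ℝ) : weightMeasure w ≪ volume :=
  withDensity_absolutelyContinuous _ _

theorem weightMeasure_carrier (w : (Fin n → ℝ) → ℝ) (Q : Cube n) :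
    weightMeasure w Q.carrier = wMass w Q :=
  withDensity_apply _ Q.measurableSet_carrier

theorem IsWeight.aemeasurable_ofReal {w : (Fin n → ℝ) → ℝ} (hw : IsWeight w) :
    AEMeasurable (fun x => ENNReal.ofReal (w x)) volume :=
  hw.1.aestronglyMeasurable.aemeasurable.ennreal_ofReal

theorem IsWeight.wMass_ne_top {w : (Fin n → ℝ) → ℝ} (hw : IsWeight w) (Q : Cube n) :
    wMass w Q ≠ ∞ := by
  have hc : IsCompact Q.carrier := by
    rw [Q.carrier_eq_Icc]
    exact isCompact_Icc
  have h := (hw.1.integrableOn_isCompact hc).hasFiniteIntegral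
  rw [hasFiniteIntegral_iff_ofReal (Filter.Eventually.of_forall hw.2)] at h
  exact h.ne

theorem wMass_mono (w : (Fin n → ℝ) → ℝ) {Q R : Cube n} (h : Q.carrier ⊆ R.carrier) :
    wMass w Q ≤ wMass w R :=
  lintegral_mono_set h

theorem lintegral_weightMeasure {w : (Fin n → ℝ) → ℝ} (hw : IsWeight w)
    {g : (Fin n → ℝ) → ℝ≥0∞} (hg : Measurable g) :
    ∫⁻ x, g x ∂weightMeasure w = ∫⁻ x, g x * ENNReal.ofReal (w x) := by
  rw [weightMeasure, lintegral_withDensity_eq_lintegral_mul₀' hw.aemeasurable_ofReal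
    hg.aemeasurable]
  simp only [Pi.mul_apply, mul_comm]

theorem IsWeight.lintegral_maximal_le {w : (Fin n → ℝ) → ℝ} (hw : IsWeight w) {R : Cube n}
    (h0 : wMass w R ≠ 0) :
    ∫⁻ x in R.carrier, maximal (R.carrier.indicator w) x ≤ AinfChar w * wMass w R := by
  have h := le_iSup (fun Q : Cube n =>
    (wMass w Q)⁻¹ * ∫⁻ x in Q.carrier, maximal (Q.carrier.indicator w) x) R
  rw [mul_comm, ← ENNReal.inv_mul_le_iff h0 (hw.wMass_ne_top R)]
  exact h

theorem inv_vol_mul_wMass_le_maximal {w : (Fin n → ℝ) → ℝ} (hw : IsWeight w) {Q R : Cube n}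
    (hQR : Q.carrier ⊆ R.carrier) {x : Fin n → ℝ} (hx : x ∈ Q.carrier) :
    (ENNReal.ofReal Q.vol)⁻¹ * wMass w Q ≤ maximal (R.carrier.indicator w) x := by
  refine le_trans (le_of_eq ?_) (le_iSup₂ (f := fun (Q : Cube n) (_ : x ∈ Q.carrier) =>
    (ENNReal.ofReal Q.vol)⁻¹ * ∫⁻ y in Q.carrier, ENNReal.ofReal |R.carrier.indicator w y|) Q hx)
  rw [wMass]
  congr 1
  refine setLIntegral_congr_fun Q.measurableSet_carrier fun y hy => ?_
  simp only [indicator_of_mem (hQR hy), abs_of_nonneg (hw.2 y)]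

/-- Carleson packing of an `A∞` weight over a sparse family. -/
theorem IsSparse.sum_wMass_le {η : ℝ} {S : Set (Cube n)} (hS : IsSparse η S) (hη : 0 < η)
    {w : (Fin n → ℝ) → ℝ} (hw : IsWeight w) {F : Finset (Cube n)} (hF : ∀ Q ∈ F, Q ∈ S)
    {R : Cube n} (hFR : ∀ Q ∈ F, Q.carrier ⊆ R.carrier) :
    ∑ Q ∈ F, wMass w Q ≤ (ENNReal.ofReal η)⁻¹ * AinfChar w * wMass w R := by
  rcases eq_or_ne (wMass w R) 0 with h0 | h0
  · rw [Finset.sum_eq_zero]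
    · exact zero_le
    · intro Q hQ
      exact le_antisymm ((wMass_mono w (hFR Q hQ)).trans h0.le) zero_le
  rw [mul_assoc]
  refine le_trans (le_of_eq ?_) ((hS.sum_le_lintegral hη hF hFR _
    (fun Q => (ENNReal.ofReal Q.vol)⁻¹ * wMass w Q)
    fun Q hQ x hx => inv_vol_mul_wMass_le_maximal hw (hFR Q hQ) hx).trans
    (mul_le_mul_right (hw.lintegral_maximal_le h0) _))
  refine Finset.sum_congr rfl fun Q _ => ?_
  have hv0 : ENNReal.ofReal Q.vol ≠ 0 := by simpa using Q.vol_pos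
  rw [mul_right_comm, ENNReal.inv_mul_cancel hv0 ENNReal.ofReal_ne_top, one_mul]

theorem IsSparse.sum_wMass_rpow_le {η : ℝ} {S : Set (Cube n)} (hS : IsSparse η S) (hη : 0 < η)
    {w : (Fin n → ℝ) → ℝ} (hw : IsWeight w) {F : Finset (Cube n)} (hF : ∀ Q ∈ F, Q ∈ S)
    {R : Cube n} (hFR : ∀ Q ∈ F, Q.carrier ⊆ R.carrier) {t : ℝ} (ht : 1 ≤ t) :
    ∑ Q ∈ F, wMass w Q ^ t ≤ (ENNReal.ofReal η)⁻¹ * AinfChar w * wMass w R ^ t := by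
  have e : ∀ z : ℝ≥0∞, z ^ t = z ^ (t - 1) * z := fun z => by
    conv_lhs => rw [show t = t - 1 + 1 by ring]
    rw [ENNReal.rpow_add_of_nonneg _ _ (by linarith) zero_le_one, ENNReal.rpow_one]
  calc ∑ Q ∈ F, wMass w Q ^ t ≤ ∑ Q ∈ F, wMass w R ^ (t - 1) * wMass w Q := by
        refine Finset.sum_le_sum fun Q hQ => ?_
        rw [e]
        exact mul_le_mul_left (ENNReal.rpow_le_rpow (wMass_mono w (hFR Q hQ)) (by linarith)) _
    _ = wMass w R ^ (t - 1) * ∑ Q ∈ F, wMass w Q := by rw [Finset.mul_sum]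
    _ ≤ wMass w R ^ (t - 1) * ((ENNReal.ofReal η)⁻¹ * AinfChar w * wMass w R) := by
        gcongr
        exact hS.sum_wMass_le hη hw hF hFR
    _ = _ := by rw [e]; ring

/-- The monomial `|Q|^u σ(Q)^v ω(Q)^z`. -/
def massMonomial (ω σ' : (Fin n → ℝ) → ℝ) (u v z : ℝ) (Q : Cube n) : ℝ≥0∞ :=
  ENNReal.ofReal Q.vol ^ u * wMass σ' Q ^ v * wMass ω Q ^ z

variable {ω σ' : (Fin n → ℝ) → ℝ}

theorem Cube.ofReal_vol_ne_zero (Q : Cube n) : ENNReal.ofReal Q.vol ≠ 0 := by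
  simpa using Q.vol_pos

theorem massMonomial_mul_of_nonneg {u v z u' v' z' : ℝ} (hv : 0 ≤ v) (hz : 0 ≤ z) (hv' : 0 ≤ v')
    (hz' : 0 ≤ z') (Q : Cube n) :
    massMonomial ω σ' u v z Q * massMonomial ω σ' u' v' z' Q =
      massMonomial ω σ' (u + u') (v + v') (z + z') Q := by
  simp only [massMonomial]
  rw [ENNReal.rpow_add _ _ Q.ofReal_vol_ne_zero ENNReal.ofReal_ne_top,
    ENNReal.rpow_add_of_nonneg _ _ hv hv', ENNReal.rpow_add_of_nonneg _ _ hz hz']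
  ring

theorem massMonomial_mul (hω : IsWeight ω) (hσ : IsWeight σ') {u v z u' v' z' : ℝ} {Q : Cube n}
    (hωQ : wMass ω Q ≠ 0) (hσQ : wMass σ' Q ≠ 0) :
    massMonomial ω σ' u v z Q * massMonomial ω σ' u' v' z' Q =
      massMonomial ω σ' (u + u') (v + v') (z + z') Q := by
  simp only [massMonomial]
  rw [ENNReal.rpow_add _ _ Q.ofReal_vol_ne_zero ENNReal.ofReal_ne_top,
    ENNReal.rpow_add _ _ hσQ (hσ.wMass_ne_top Q), ENNReal.rpow_add _ _ hωQ (hω.wMass_ne_top Q)]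
  ring

theorem massMonomial_rpow {u v z t : ℝ} (ht : 0 ≤ t) (Q : Cube n) :
    massMonomial ω σ' u v z Q ^ t = massMonomial ω σ' (u * t) (v * t) (z * t) Q := by
  simp only [massMonomial]
  rw [ENNReal.mul_rpow_of_nonneg _ _ ht, ENNReal.mul_rpow_of_nonneg _ _ ht, ENNReal.rpow_mul,
    ENNReal.rpow_mul, ENNReal.rpow_mul]

theorem massMonomial_mono {u v z : ℝ} (hu : 0 ≤ u) (hv : 0 ≤ v) (hz : 0 ≤ z) {Q R : Cube n}
    (h : Q.carrier ⊆ R.carrier) : massMonomial ω σ' u v z Q ≤ massMonomial ω σ' u v z R := by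
  have hvol : ENNReal.ofReal Q.vol ≤ ENNReal.ofReal R.vol := by
    rw [← Q.volume_carrier, ← R.volume_carrier]
    exact measure_mono h
  exact mul_le_mul' (mul_le_mul' (ENNReal.rpow_le_rpow hvol hu)
    (ENNReal.rpow_le_rpow (wMass_mono σ' h) hv)) (ENNReal.rpow_le_rpow (wMass_mono ω h) hz)

theorem massMonomial_le_twoWeightChar {S : Set (Cube n)} {Q : Cube n} (hQ : Q ∈ S) (p q α : ℝ) :
    massMonomial ω σ' (-α) (1 - 1 / p) (1 / q) Q ≤ twoWeightChar p q α S ω σ' := by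
  refine le_trans (le_of_eq ?_) (le_iSup₂ (f := fun (Q : Cube n) (_ : Q ∈ S) =>
    ENNReal.ofReal Q.vol ^ (-α) * wMass ω Q ^ (1 / q) * wMass σ' Q ^ (1 - 1 / p)) Q hQ)
  rw [massMonomial, mul_right_comm]

/-- Monomials of total degree at least one are summable over a sparse family below a cube. -/
theorem IsSparse.sum_massMonomial_le {η : ℝ} {S : Set (Cube n)} (hS : IsSparse η S) (hη : 0 < η)
    (hdy : ∀ Q ∈ S, Q.IsDyadic) (hω : IsWeight ω) (hσ : IsWeight σ')
    {F : Finset (Cube n)} (hF : ∀ Q ∈ F, Q ∈ S)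
    {R : Cube n} (hFR : ∀ Q ∈ F, Q.carrier ⊆ R.carrier) {a b c γ : ℝ} (ha : 0 < a) (hb : 0 < b)
    (hγ : 0 < γ) (hγab : γ ≤ a + b) (hγc : 1 ≤ c + γ) :
    ∑ Q ∈ F, massMonomial ω σ' c a b Q ≤ kolmogorovConst η γ * massMonomial ω σ' c a b R := by
  have hab : 0 < a + b := by positivity
  set x := a / (a + b) with hx
  set y := b / (a + b) with hy
  have hx0 : 0 ≤ x := by positivity
  have hy0 : 0 ≤ y := by positivity
  have hxy : x + y = 1 := by rw [hx, hy]; field_simp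
  have hxa : x * γ ≤ a := by
    rw [hx, div_mul_eq_mul_div, div_le_iff₀ hab]
    exact mul_le_mul_of_nonneg_left hγab ha.le
  have hyb : y * γ ≤ b := by
    rw [hy, div_mul_eq_mul_div, div_le_iff₀ hab]
    exact mul_le_mul_of_nonneg_left hγab hb.le
  have hsplit : ∀ Q : Cube n, massMonomial ω σ' c a b Q =
      massMonomial ω σ' (c + γ - 1) (a - x * γ) (b - y * γ) Q *
        ((ENNReal.ofReal Q.vol ^ (1 - γ) * wMass σ' Q ^ γ) ^ x *
          (ENNReal.ofReal Q.vol ^ (1 - γ) * wMass ω Q ^ γ) ^ y) := by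
    intro Q
    have h1 : (ENNReal.ofReal Q.vol ^ (1 - γ) * wMass σ' Q ^ γ) ^ x *
        (ENNReal.ofReal Q.vol ^ (1 - γ) * wMass ω Q ^ γ) ^ y =
        massMonomial ω σ' (1 - γ) (x * γ) (y * γ) Q := by
      have h2 : ENNReal.ofReal Q.vol ^ (1 - γ) = ENNReal.ofReal Q.vol ^ ((1 - γ) * x) *
          ENNReal.ofReal Q.vol ^ ((1 - γ) * y) := by
        rw [← ENNReal.rpow_add _ _ Q.ofReal_vol_ne_zero ENNReal.ofReal_ne_top, ← mul_add, hxy,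
          mul_one]
      rw [massMonomial, h2, ← ENNReal.rpow_add _ _ Q.ofReal_vol_ne_zero ENNReal.ofReal_ne_top,
        ← mul_add, hxy, mul_one, ENNReal.mul_rpow_of_nonneg _ _ hx0,
        ENNReal.mul_rpow_of_nonneg _ _ hy0, ← ENNReal.rpow_mul, ← ENNReal.rpow_mul,
        ← ENNReal.rpow_mul, ← ENNReal.rpow_mul, h2, mul_comm γ x, mul_comm γ y]
      ring
    rw [h1, massMonomial_mul_of_nonneg (by linarith) (by linarith) (by positivity)
      (by positivity)]
    congr 1 <;> ring
  have hkol : ∀ {w : (Fin n → ℝ) → ℝ}, IsWeight w →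
      ∑ Q ∈ F, ENNReal.ofReal Q.vol ^ (1 - γ) * wMass w Q ^ γ ≤
        kolmogorovConst η γ * (ENNReal.ofReal R.vol ^ (1 - γ) * wMass w R ^ γ) := by
    intro w hw
    simp only [← weightMeasure_carrier]
    exact hS.sum_vol_rpow_mul_rpow_le hη hdy (weightMeasure_absolutelyContinuous w) hF
      (by rw [weightMeasure_carrier]; exact hw.wMass_ne_top R) hFR hγ
  calc ∑ Q ∈ F, massMonomial ω σ' c a b Q
      ≤ ∑ Q ∈ F, massMonomial ω σ' (c + γ - 1) (a - x * γ) (b - y * γ) R *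
        ((ENNReal.ofReal Q.vol ^ (1 - γ) * wMass σ' Q ^ γ) ^ x *
          (ENNReal.ofReal Q.vol ^ (1 - γ) * wMass ω Q ^ γ) ^ y) := by
        refine Finset.sum_le_sum fun Q hQ => ?_
        rw [hsplit Q]
        exact mul_le_mul_left (massMonomial_mono (by linarith) (by linarith) (by linarith)
          (hFR Q hQ)) _
    _ ≤ massMonomial ω σ' (c + γ - 1) (a - x * γ) (b - y * γ) R *
        ((kolmogorovConst η γ * (ENNReal.ofReal R.vol ^ (1 - γ) * wMass σ' R ^ γ)) ^ x *
          (kolmogorovConst η γ * (ENNReal.ofReal R.vol ^ (1 - γ) * wMass ω R ^ γ)) ^ y) := by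
        rw [← Finset.mul_sum]
        refine mul_le_mul_right ((sum_rpow_mul_rpow_le F _ _ hx0 hy0 hxy).trans ?_) _
        exact mul_le_mul' (ENNReal.rpow_le_rpow (hkol hσ) hx0) (ENNReal.rpow_le_rpow (hkol hω) hy0)
    _ = kolmogorovConst η γ * massMonomial ω σ' c a b R := by
        have h1 : kolmogorovConst η γ = kolmogorovConst η γ ^ x * kolmogorovConst η γ ^ y := by
          rw [← ENNReal.rpow_add_of_nonneg _ _ hx0 hy0, hxy, ENNReal.rpow_one]
        rw [ENNReal.mul_rpow_of_nonneg _ _ hx0, ENNReal.mul_rpow_of_nonneg _ _ hy0, hsplit R]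
        conv_rhs => rw [h1]
        ring

/-- The endpoint case of `IsSparse.sum_massMonomial_le`, where the `A∞` constants enter. -/
theorem IsSparse.sum_massMonomial_le_of_add_eq_one {η : ℝ} {S : Set (Cube n)}
    (hS : IsSparse η S) (hη : 0 < η) (hω : IsWeight ω) (hσ : IsWeight σ')
    {F : Finset (Cube n)} (hF : ∀ Q ∈ F, Q ∈ S)
    {R : Cube n} (hFR : ∀ Q ∈ F, Q.carrier ⊆ R.carrier) {a b : ℝ} (ha : 0 ≤ a) (hb : 0 ≤ b)
    (hab : a + b = 1) :
    ∑ Q ∈ F, massMonomial ω σ' 0 a b Q ≤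
      (ENNReal.ofReal η)⁻¹ * (AinfChar σ' ^ a * AinfChar ω ^ b) * massMonomial ω σ' 0 a b R := by
  simp only [massMonomial, ENNReal.rpow_zero, one_mul]
  refine ((sum_rpow_mul_rpow_le F _ _ ha hb hab).trans (mul_le_mul'
    (ENNReal.rpow_le_rpow (hS.sum_wMass_le hη hσ hF hFR) ha)
    (ENNReal.rpow_le_rpow (hS.sum_wMass_le hη hω hF hFR) hb))).trans (le_of_eq ?_)
  have h1 : (ENNReal.ofReal η)⁻¹ = (ENNReal.ofReal η)⁻¹ ^ a * (ENNReal.ofReal η)⁻¹ ^ b := by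
    rw [← ENNReal.rpow_add_of_nonneg _ _ ha hb, hab, ENNReal.rpow_one]
  simp only [ENNReal.mul_rpow_of_nonneg _ _ ha, ENNReal.mul_rpow_of_nonneg _ _ hb]
  conv_rhs => rw [h1]
  ring

end Weights

section Testing

variable {n : ℕ} {ω σ' : (Fin n → ℝ) → ℝ} {S : Set (Cube n)} {η p q r α : ℝ}

/-- The coefficient `|Q|^{-αr} σ(Q)^r` in the testing sums. -/
def testCoeff (σ' : (Fin n → ℝ) → ℝ) (α r : ℝ) (Q : Cube n) : ℝ≥0∞ :=
  ENNReal.ofReal Q.vol ^ (-(α * r)) * wMass σ' Q ^ r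

theorem testCoeff_ne_top (hσ : IsWeight σ') (hr : 0 < r) (Q : Cube n) :
    testCoeff σ' α r Q ≠ ∞ :=
  ENNReal.mul_ne_top (ENNReal.rpow_ne_top_of_ne_zero Q.ofReal_vol_ne_zero ENNReal.ofReal_ne_top)
    (ENNReal.rpow_ne_top_of_nonneg hr.le (hσ.wMass_ne_top Q))

theorem testCoeff_mul_wMass (Q : Cube n) :
    testCoeff σ' α r Q * wMass ω Q = massMonomial ω σ' (-(α * r)) r 1 Q := by
  simp [testCoeff, massMonomial]

theorem testCoeff_eq_zero (hr : 0 < r) {Q : Cube n} (h : wMass σ' Q = 0) :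
    testCoeff σ' α r Q = 0 := by
  simp [testCoeff, h, hr]

theorem massMonomial_rpow_le_twoWeightChar {Q : Cube n} (hQ : Q ∈ S) {t : ℝ} (ht : 0 ≤ t)
    {u v z : ℝ} (hu : u = -α * t) (hv : v = (1 - 1 / p) * t) (hz : z = 1 / q * t) :
    massMonomial ω σ' u v z Q ≤ twoWeightChar p q α S ω σ' ^ t := by
  subst hu hv hz
  rw [← massMonomial_rpow ht]
  exact ENNReal.rpow_le_rpow (massMonomial_le_twoWeightChar hQ p q α) ht

/-- The local `L^{q/r}` estimate, given a summability bound for a suitable monomial. -/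
theorem lintegral_testSum_rpow_le (hω : IsWeight ω) (hσ : IsWeight σ')
    (hdy : ∀ Q ∈ S, Q.IsDyadic) {F : Finset (Cube n)} (hF : ∀ Q ∈ F, Q ∈ S)
    (hr : 0 < r) (hrq : r < q) {θ : ℝ} (hθ : 0 ≤ θ) (hθ1 : θ * (q / r - 1) ≤ 1) {L : ℝ≥0∞}
    (hL : ∀ Q ∈ F, ∀ G ⊆ F, (∀ Q' ∈ G, Q'.carrier ⊆ Q.carrier) →
      ∑ Q' ∈ G, massMonomial ω σ' (α * q * θ - α * r) (r - θ * q * (1 - 1 / p)) (1 - θ) Q' ≤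
        L * massMonomial ω σ' (α * q * θ - α * r) (r - θ * q * (1 - 1 / p)) (1 - θ) Q) :
    ∫⁻ x, (∑ Q ∈ F, Q.carrier.indicator (fun _ => testCoeff σ' α r Q) x) ^ (q / r)
        ∂weightMeasure ω ≤
      nestedConst (q / r) * L ^ (q / r - 1) * twoWeightChar p q α S ω σ' ^ q *
        ∑ Q ∈ F, wMass σ' Q ^ (q / p) := by
  classical
  have hq : 0 < q := hr.trans hrq
  set A := twoWeightChar p q α S ω σ' with hA
  set a := r - θ * q * (1 - 1 / p) with ha
  set c := α * q * θ - α * r with hc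
  have hs : 1 < q / r := by rwa [one_lt_div hr]
  set s := q / r with hsdef
  have hrs : r * s = q := by rw [hsdef]; field_simp
  have hs0 : 0 ≤ s - 1 := by linarith
  have hterm : ∀ Q ∈ F, testCoeff σ' α r Q * wMass ω Q ≤
      A ^ (q * θ) * massMonomial ω σ' c a (1 - θ) Q := by
    intro Q hQ
    rcases eq_or_ne (wMass σ' Q) 0 with h0 | h0
    · rw [testCoeff_eq_zero hr h0, zero_mul]
      exact zero_le
    rcases eq_or_ne (wMass ω Q) 0 with h1 | h1
    · rw [h1, mul_zero]
      exact zero_le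
    have hsplit : massMonomial ω σ' (-(α * r)) r 1 Q =
        massMonomial ω σ' (-α * (q * θ)) ((1 - 1 / p) * (q * θ)) (1 / q * (q * θ)) Q *
          massMonomial ω σ' c a (1 - θ) Q := by
      rw [massMonomial_mul hω hσ h1 h0]
      congr 1
      · rw [hc]; ring
      · rw [ha]; ring
      · field_simp
        ring
    rw [testCoeff_mul_wMass, hsplit]
    exact mul_le_mul_left
      (massMonomial_rpow_le_twoWeightChar (hF Q hQ) (by positivity) rfl rfl rfl) _
  have hmain : ∀ Q ∈ F, testCoeff σ' α r Q * (weightMeasure ω Q.carrier *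
      localAverage (weightMeasure ω) F Cube.carrier (testCoeff σ' α r) Q ^ (s - 1)) ≤
      L ^ (s - 1) * A ^ q * wMass σ' Q ^ (q / p) := by
    intro Q hQ
    rw [weightMeasure_carrier]
    rcases eq_or_ne (wMass σ' Q) 0 with h0 | h0
    · rw [testCoeff_eq_zero hr h0, zero_mul]
      exact zero_le
    rcases eq_or_ne (wMass ω Q) 0 with h1 | h1
    · rw [h1, zero_mul, mul_zero]
      exact zero_le
    have hav : localAverage (weightMeasure ω) F Cube.carrier (testCoeff σ' α r) Q ≤
        A ^ (q * θ) * L * massMonomial ω σ' c a (-θ) Q := by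
      simp only [localAverage, weightMeasure_carrier]
      calc (wMass ω Q)⁻¹ *
            ∑ Q' ∈ F with Q'.carrier ⊆ Q.carrier, testCoeff σ' α r Q' * wMass ω Q'
          ≤ (wMass ω Q)⁻¹ * (A ^ (q * θ) * (L * massMonomial ω σ' c a (1 - θ) Q)) := by
            refine mul_le_mul_right ((Finset.sum_le_sum fun Q' hQ' =>
              hterm Q' (Finset.mem_filter.1 hQ').1).trans ?_) _
            rw [← Finset.mul_sum]
            exact mul_le_mul_right (hL Q hQ _ (Finset.filter_subset _ _)
              fun Q' hQ' => (Finset.mem_filter.1 hQ').2) _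
        _ = A ^ (q * θ) * L *
            (massMonomial ω σ' 0 0 (-1) Q * massMonomial ω σ' c a (1 - θ) Q) := by
            have : (wMass ω Q)⁻¹ = massMonomial ω σ' 0 0 (-1) Q := by
              simp [massMonomial, ENNReal.rpow_neg_one]
            rw [this]
            ring
        _ = _ := by
            rw [massMonomial_mul hω hσ h1 h0]
            congr 2 <;> ring
    have hτ : 0 ≤ 1 - θ * (s - 1) := by linarith
    calc testCoeff σ' α r Q * (wMass ω Q *
          localAverage (weightMeasure ω) F Cube.carrier (testCoeff σ' α r) Q ^ (s - 1))
        ≤ testCoeff σ' α r Q * (wMass ω Q *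
            (A ^ (q * θ) * L * massMonomial ω σ' c a (-θ) Q) ^ (s - 1)) :=
          mul_le_mul_right (mul_le_mul_right (ENNReal.rpow_le_rpow hav hs0) _) _
      _ = L ^ (s - 1) * A ^ (q * θ * (s - 1)) * (massMonomial ω σ' (-(α * r)) r 1 Q *
            massMonomial ω σ' (c * (s - 1)) (a * (s - 1)) (-θ * (s - 1)) Q) := by
          rw [ENNReal.mul_rpow_of_nonneg _ _ hs0, ENNReal.mul_rpow_of_nonneg _ _ hs0,
            massMonomial_rpow hs0, ← ENNReal.rpow_mul, ← testCoeff_mul_wMass]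
          ring
      _ = L ^ (s - 1) * A ^ (q * θ * (s - 1)) *
          (massMonomial ω σ' (-α * (q * (1 - θ * (s - 1))))
            ((1 - 1 / p) * (q * (1 - θ * (s - 1)))) (1 / q * (q * (1 - θ * (s - 1)))) Q *
            massMonomial ω σ' 0 (q / p) 0 Q) := by
          rw [massMonomial_mul hω hσ h1 h0, massMonomial_mul hω hσ h1 h0]
          congr 2
          · rw [hc]
            linear_combination α * hrs - 2 * α * hrs
          · rw [ha, div_eq_mul_one_div q p]
            linear_combination hrs
          · field_simp
            ring
      _ ≤ L ^ (s - 1) * A ^ (q * θ * (s - 1)) *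
          (A ^ (q * (1 - θ * (s - 1))) * wMass σ' Q ^ (q / p)) := by
          refine mul_le_mul_right (mul_le_mul'
            (massMonomial_rpow_le_twoWeightChar (hF Q hQ) (by positivity) rfl rfl rfl)
            (le_of_eq ?_)) _
          simp [massMonomial]
      _ = _ := by
          have hAq : A ^ q = A ^ (q * θ * (s - 1)) * A ^ (q * (1 - θ * (s - 1))) := by
            rw [← ENNReal.rpow_add_of_nonneg _ _ (by positivity) (by positivity)]
            congr 1
            ring
          rw [hAq]
          ring
  refine (lintegral_sum_rpow_le (fun Q _ => Q.measurableSet_carrier)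
    (fun Q _ => by rw [weightMeasure_carrier]; exact hω.wMass_ne_top Q)
    (fun Q _ => testCoeff_ne_top hσ hr Q)
    (aeNested_of_isDyadic (weightMeasure_absolutelyContinuous ω) fun Q hQ => hdy Q (hF Q hQ))
    hs).trans ?_
  rw [mul_assoc (nestedConst s), mul_assoc (nestedConst s)]
  refine mul_le_mul_right ?_ _
  rw [Finset.mul_sum]
  exact Finset.sum_le_sum hmain

theorem lintegral_testSum_rpow_le_of_le {F : Finset (Cube n)} (hF : ∀ Q ∈ F, Q ∈ S)
    (hp : 1 < p) (hq : 0 < q) (hr : 0 < r) (hqr : q ≤ r) :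
    ∫⁻ x, (∑ Q ∈ F, Q.carrier.indicator (fun _ => testCoeff σ' α r Q) x) ^ (q / r)
        ∂weightMeasure ω ≤
      twoWeightChar p q α S ω σ' ^ q * ∑ Q ∈ F, wMass σ' Q ^ (q / p) := by
  have hs : 0 < q / r := by positivity
  have hs1 : q / r ≤ 1 := (div_le_one hr).2 hqr
  have hp' : 0 ≤ 1 - 1 / p := by
    rw [sub_nonneg, div_le_one (by linarith)]
    exact hp.le
  calc ∫⁻ x, (∑ Q ∈ F, Q.carrier.indicator (fun _ => testCoeff σ' α r Q) x) ^ (q / r)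
        ∂weightMeasure ω
      ≤ ∫⁻ x, ∑ Q ∈ F, Q.carrier.indicator (fun _ => testCoeff σ' α r Q ^ (q / r)) x
          ∂weightMeasure ω := by
        refine lintegral_mono fun x => (sum_rpow_le_of_le_one F _ hs hs1).trans (le_of_eq ?_)
        refine Finset.sum_congr rfl fun Q _ => ?_
        by_cases hx : x ∈ Q.carrier <;> simp [hx, hs]
    _ = ∑ Q ∈ F, testCoeff σ' α r Q ^ (q / r) * weightMeasure ω Q.carrier :=
        lintegral_sum_indicator_const F _ fun Q _ => Q.measurableSet_carrier
    _ ≤ _ := by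
        rw [Finset.mul_sum]
        refine Finset.sum_le_sum fun Q hQ => ?_
        have h1 : testCoeff σ' α r Q ^ (q / r) * weightMeasure ω Q.carrier =
            massMonomial ω σ' (-α * q) ((1 - 1 / p) * q) (1 / q * q) Q *
              massMonomial ω σ' 0 (q / p) 0 Q := by
          rw [massMonomial_mul_of_nonneg (by positivity) (by positivity) (by positivity) le_rfl,
            weightMeasure_carrier, testCoeff, ENNReal.mul_rpow_of_nonneg _ _ hs.le,
            ← ENNReal.rpow_mul, ← ENNReal.rpow_mul, massMonomial,
            show 1 / q * q + 0 = 1 by field_simp; ring, ENNReal.rpow_one,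
            show -(α * r) * (q / r) = -α * q + 0 by field_simp; ring,
            show r * (q / r) = (1 - 1 / p) * q + q / p by field_simp; ring]
        rw [h1]
        refine mul_le_mul' (massMonomial_rpow_le_twoWeightChar (hF Q hQ) hq.le rfl rfl rfl)
          (le_of_eq ?_)
        simp [massMonomial]

end Testing

section Countable

variable {n : ℕ}

theorem countable_setOf_isDyadic : {Q : Cube n | Q.IsDyadic}.Countable := by
  refine (countable_range fun jm : ℤ × (Fin n → ℤ) =>
    (⟨fun i => (jm.2 i : ℝ) * (2 : ℝ) ^ (-jm.1), (2 : ℝ) ^ (-jm.1), by positivity⟩ :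
      Cube n)).mono ?_
  rintro ⟨c, l, hl⟩ ⟨j, m, h1, h2⟩
  refine ⟨(j, m), ?_⟩
  simp only at h1 h2
  subst h1
  obtain rfl : c = _ := funext h2
  rfl

theorem eNorm_cubeSum_le {w : (Fin n → ℝ) → ℝ} (hw : IsWeight w) {D : Set (Cube n)}
    (hD : ∀ Q ∈ D, Q.IsDyadic) {g : Cube n → ℝ≥0∞} {s : ℝ} (hs : 0 < s) {B : ℝ≥0∞}
    (h : ∀ F : Finset (Cube n), (∀ Q ∈ F, Q ∈ D) →
      ∫⁻ x, (∑ Q ∈ F, Q.carrier.indicator (fun _ => g Q) x) ^ s ∂weightMeasure w ≤ B) :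
    eNorm s w (cubeSum D g) ≤ B ^ (1 / s) := by
  classical
  have hcount : Countable D := (countable_setOf_isDyadic.mono hD).to_subtype
  have hsup : ∀ x, cubeSum D g x ^ s = ⨆ G : Finset D,
      (∑ Q ∈ G, Q.1.carrier.indicator (fun _ => g Q.1) x) ^ s := by
    intro x
    rw [cubeSum, ENNReal.tsum_eq_iSup_sum]
    exact (ENNReal.orderIsoRpow s hs).map_iSup _
  have hmeas : ∀ G : Finset D, Measurable fun x =>
      (∑ Q ∈ G, Q.1.carrier.indicator (fun _ => g Q.1) x) ^ s := fun G =>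
    (measurable_sum_indicator_const G (fun Q : D => g Q.1)
      fun Q _ => Q.1.measurableSet_carrier).pow_const s
  have hsupm : Measurable fun x => cubeSum D g x ^ s := by
    simp only [hsup]
    exact Measurable.iSup hmeas
  refine ENNReal.rpow_le_rpow ?_ (by positivity)
  rw [← lintegral_weightMeasure hw hsupm]
  simp only [hsup]
  rw [lintegral_iSup_directed (fun G => (hmeas G).aemeasurable)]
  · refine iSup_le fun G => ?_
    refine le_trans (le_of_eq ?_) (h (G.map (Function.Embedding.subtype _)) ?_)
    · simp
    · intro Q hQ
      obtain ⟨Q', -, rfl⟩ := Finset.mem_map.1 hQ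
      exact Q'.2
  · refine Monotone.directed_le fun G G' hG x => ?_
    exact ENNReal.rpow_le_rpow (Finset.sum_le_sum_of_subset hG) hs.le

end Countable

section Testing

variable {n : ℕ} {ω σ' : (Fin n → ℝ) → ℝ} {S : Set (Cube n)} {η p q r α : ℝ}

/-- Reduction of the testing constant to local estimates over finite subfamilies. -/
theorem testT_le (hS : IsSparse η S) (hη : 0 < η) (hdy : ∀ Q ∈ S, Q.IsDyadic) (hω : IsWeight ω)
    (hσ : IsWeight σ') (hp : 1 < p) (hpq : p ≤ q) (hr : 0 < r) {K : ℝ≥0∞}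
    (h : ∀ F : Finset (Cube n), (∀ Q ∈ F, Q ∈ S) →
      ∫⁻ x, (∑ Q ∈ F, Q.carrier.indicator (fun _ => testCoeff σ' α r Q) x) ^ (q / r)
        ∂weightMeasure ω ≤
      K * twoWeightChar p q α S ω σ' ^ q * ∑ Q ∈ F, wMass σ' Q ^ (q / p)) :
    testT p q r α S ω σ' ≤ (K * (ENNReal.ofReal η)⁻¹) ^ (r / q) *
      twoWeightChar p q α S ω σ' ^ r * AinfChar σ' ^ (r / q) := by
  have hp0 : 0 < p := by linarith
  have hq : 0 < q := by linarith
  have hrq : 0 < r / q := by positivity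
  refine iSup₂_le fun R _ => ?_
  have hnorm := eNorm_cubeSum_le hω (D := {Q | Q ∈ S ∧ Q.carrier ⊆ R.carrier})
    (fun Q hQ => hdy Q hQ.1) (g := testCoeff σ' α r) (s := q / r) (by positivity)
    (B := K * (ENNReal.ofReal η)⁻¹ * twoWeightChar p q α S ω σ' ^ q * AinfChar σ' *
      wMass σ' R ^ (q / p)) (fun F hF => by
      refine (h F fun Q hQ => (hF Q hQ).1).trans ((mul_le_mul_right (hS.sum_wMass_rpow_le hη hσ
        (fun Q hQ => (hF Q hQ).1) (fun Q hQ => (hF Q hQ).2)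
        ((one_le_div hp0).2 hpq)) _).trans (le_of_eq ?_))
      ring)
  have hinv : 1 / (q / r) = r / q := by rw [one_div_div]
  rw [hinv] at hnorm
  simp only [ENNReal.mul_rpow_of_nonneg _ _ hrq.le, ← ENNReal.rpow_mul] at hnorm ⊢
  rw [show q * (r / q) = r by field_simp, show q / p * (r / q) = r / p by field_simp] at hnorm
  refine (mul_le_mul_right hnorm _).trans ?_
  rcases eq_or_ne (wMass σ' R) 0 with h0 | h0
  · rw [h0, ENNReal.zero_rpow_of_pos (by positivity : 0 < r / p), mul_zero, mul_zero]
    exact zero_le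
  · have hone : wMass σ' R ^ (-(r / p)) * wMass σ' R ^ (r / p) = 1 := by
      rw [← ENNReal.rpow_add _ _ h0 (hσ.wMass_ne_top R), neg_add_cancel, ENNReal.rpow_zero]
    rw [mul_left_comm, hone, mul_one]

/-- The exponents used off the critical line `p = q`, `α < 1`. -/
theorem exists_interpolation_exponent (hp : 1 < p) (hpq : p ≤ q) (hr : 0 < r)
    (hrq : r < q) (h : p = q → α = 1) :
    ∃ θ, r / q < θ ∧ θ * (q / r - 1) ≤ 1 ∧ θ < 1 ∧ 0 < r - θ * q * (1 - 1 / p) ∧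
      1 ≤ (α * q * θ - α * r) + ((r - θ * q * (1 - 1 / p)) + (1 - θ)) := by
  have hq : 0 < q := by linarith
  have hp0 : 0 < p := by linarith
  have e1 : ∀ᶠ θ in nhds (r / q), θ * (q / r - 1) < 1 := by
    refine ContinuousAt.eventually_lt (by fun_prop) continuousAt_const ?_
    field_simp
    linarith
  have e2 : ∀ᶠ θ in nhds (r / q), θ < 1 :=
    eventually_lt_nhds ((div_lt_one hq).2 hrq)
  have e3 : ∀ᶠ θ in nhds (r / q), 0 < r - θ * q * (1 - 1 / p) := by
    refine ContinuousAt.eventually_lt continuousAt_const (by fun_prop) ?_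
    have : r - r / q * q * (1 - 1 / p) = r / p := by field_simp; ring
    rw [this]
    positivity
  have e4 : ∀ᶠ θ in nhds (r / q),
      1 ≤ (α * q * θ - α * r) + ((r - θ * q * (1 - 1 / p)) + (1 - θ)) := by
    rcases hpq.eq_or_lt with rfl | hlt
    · refine Filter.Eventually.of_forall fun θ => le_of_eq ?_
      rw [h rfl]
      field_simp
      ring
    · have : ∀ᶠ θ in nhds (r / q),
          1 < (α * q * θ - α * r) + ((r - θ * q * (1 - 1 / p)) + (1 - θ)) := by
        refine ContinuousAt.eventually_lt continuousAt_const (by fun_prop) ?_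
        have h1 : (α * q * (r / q) - α * r) + ((r - r / q * q * (1 - 1 / p)) + (1 - r / q)) =
            1 + r * (1 / p - 1 / q) := by field_simp; ring
        rw [h1]
        have h2 : 0 < 1 / p - 1 / q := sub_pos.2 (one_div_lt_one_div_of_lt hp0 hlt)
        linarith [mul_pos hr h2]
      exact this.mono fun _ => le_of_lt
  obtain ⟨θ, ⟨⟨⟨h1, h2⟩, h3⟩, h4⟩, h5⟩ :=
    (((((e1.and e2).and e3).and e4).filter_mono nhdsWithin_le_nhds).and
      (self_mem_nhdsWithin : Ioi (r / q) ∈ nhdsWithin (r / q) (Ioi (r / q)))).exists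
  exact ⟨θ, h5, h1.le, h2, h3, h4⟩

theorem exists_kolmogorov_exponent {c d : ℝ} (hc : 0 < c) (hd : 0 < d) (h : 1 ≤ c + d) :
    ∃ γ, 0 < γ ∧ γ < 1 ∧ γ ≤ d ∧ 1 ≤ c + γ := by
  rcases lt_or_ge d 1 with h1 | h1
  · exact ⟨d, hd, h1, le_rfl, h⟩
  · refine ⟨max (1 - c) (1 / 2), lt_max_of_lt_right (by norm_num),
      max_lt (by linarith) (by norm_num), max_le (by linarith) (by linarith), ?_⟩
    linarith [le_max_left (1 - c) (1 / 2)]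

theorem exists_testT_le (n : ℕ) (hη : 0 < η) (hp : 1 < p) (hpq : p ≤ q)
    (hr : 0 < r) (hα : 0 < α) (hpqα : p = q → r < q → α = 1) :
    ∃ K : ℝ≥0∞, K ≠ ∞ ∧ ∀ ω σ' : (Fin n → ℝ) → ℝ, IsWeight ω → IsWeight σ' →
      ∀ S : Set (Cube n), (∀ Q ∈ S, Q.IsDyadic) → IsSparse η S →
        testT p q r α S ω σ' ≤
          K * twoWeightChar p q α S ω σ' ^ r * AinfChar σ' ^ (r / q) := by
  have hq : 0 < q := by linarith
  have hrq0 : 0 ≤ r / q := by positivity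
  have hηtop : (ENNReal.ofReal η)⁻¹ ≠ ∞ := by simpa using hη
  rcases le_or_gt q r with hqr | hrq
  · refine ⟨(1 * (ENNReal.ofReal η)⁻¹) ^ (r / q),
      ENNReal.rpow_ne_top_of_nonneg hrq0 (ENNReal.mul_ne_top one_ne_top hηtop),
      fun ω σ' hω hσ S hdy hS => testT_le hS hη hdy hω hσ hp hpq hr fun F hF => ?_⟩
    rw [one_mul]
    exact lintegral_testSum_rpow_le_of_le hF hp hq hr hqr
  · obtain ⟨θ, hθ, hθ1, hθ2, ha, hdeg⟩ :=
      exists_interpolation_exponent hp hpq hr hrq fun h => hpqα h hrq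
    have hθ0 : 0 ≤ θ := hrq0.trans hθ.le
    have hc : 0 < α * q * θ - α * r := by
      rw [div_lt_iff₀ hq] at hθ
      have := mul_pos hα (sub_pos.2 hθ)
      linarith
    have hb : 0 < 1 - θ := by linarith
    obtain ⟨γ, hγ, hγ1, hγd, hγc⟩ := exists_kolmogorov_exponent hc (by positivity) hdeg
    have hs : 1 < q / r := by rwa [one_lt_div hr]
    refine ⟨(nestedConst (q / r) * kolmogorovConst η γ ^ (q / r - 1) *
      (ENNReal.ofReal η)⁻¹) ^ (r / q), ?_,
      fun ω σ' hω hσ S hdy hS => testT_le hS hη hdy hω hσ hp hpq hr fun F hF => ?_⟩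
    · exact ENNReal.rpow_ne_top_of_nonneg hrq0 (ENNReal.mul_ne_top (ENNReal.mul_ne_top
        (nestedConst_ne_top hs) (ENNReal.rpow_ne_top_of_nonneg (by linarith)
          (kolmogorovConst_ne_top hη hγ1))) hηtop)
    · exact lintegral_testSum_rpow_le hω hσ hdy hF hr hrq hθ0 hθ1 fun Q _ G hG hGQ =>
        hS.sum_massMonomial_le hη hdy hω hσ (fun Q' hQ' => hF Q' (hG hQ')) hGQ ha hb hγ hγd hγc

theorem exists_testT_le_diagonal (n : ℕ) (hη : 0 < η) (hp : 1 < p) (hr : 0 < r) (hrp : r < p)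
    (α : ℝ) :
    ∃ K : ℝ≥0∞, K ≠ ∞ ∧ ∀ ω σ' : (Fin n → ℝ) → ℝ, IsWeight ω → IsWeight σ' →
      ∀ S : Set (Cube n), (∀ Q ∈ S, Q.IsDyadic) → IsSparse η S →
        testT p p r α S ω σ' ≤ K * twoWeightChar p p α S ω σ' ^ r *
          (AinfChar σ' ^ (1 - (1 - r / p) ^ 2) * AinfChar ω ^ ((1 - r / p) ^ 2)) := by
  have hp0 : 0 < p := by linarith
  set t := r / p with ht
  have ht0 : 0 ≤ t := by positivity
  have ht1 : t < 1 := (div_lt_one hp0).2 hrp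
  have hs : 1 < p / r := by rwa [one_lt_div hr]
  have hs0 : 0 ≤ p / r - 1 := by linarith
  have hst : (p / r - 1) * t = 1 - t := by rw [ht]; field_simp
  have hηtop : (ENNReal.ofReal η)⁻¹ ≠ ∞ := by simpa using hη
  refine ⟨nestedConst (p / r) ^ t * (ENNReal.ofReal η)⁻¹ ^ (1 - t) * (ENNReal.ofReal η)⁻¹ ^ t,
    ENNReal.mul_ne_top (ENNReal.mul_ne_top
      (ENNReal.rpow_ne_top_of_nonneg ht0 (nestedConst_ne_top hs))
      (ENNReal.rpow_ne_top_of_nonneg (by linarith) hηtop))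
      (ENNReal.rpow_ne_top_of_nonneg ht0 hηtop), fun ω σ' hω hσ S hdy hS => ?_⟩
  have hkey := testT_le (α := α) hS hη hdy hω hσ hp le_rfl hr fun F hF =>
    lintegral_testSum_rpow_le hω hσ hdy hF hr hrp (θ := t)
      (L := (ENNReal.ofReal η)⁻¹ * (AinfChar σ' ^ t * AinfChar ω ^ (1 - t))) ht0
      (by linarith) fun Q _ G hG hGQ => by
        rw [show α * p * t - α * r = 0 by rw [ht]; field_simp; ring,
          show r - t * p * (1 - 1 / p) = t by rw [ht]; field_simp; ring]
        exact hS.sum_massMonomial_le_of_add_eq_one hη hω hσ (fun Q' hQ' => hF Q' (hG hQ')) hGQ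
          ht0 (by linarith) (by ring)
  refine hkey.trans (le_of_eq ?_)
  have hσpow : AinfChar σ' ^ (1 - (1 - t) ^ 2) = AinfChar σ' ^ (t * (1 - t)) * AinfChar σ' ^ t := by
    rw [← ENNReal.rpow_add_of_nonneg _ _ (mul_nonneg ht0 (by linarith)) ht0]
    congr 1
    ring
  simp only [ENNReal.mul_rpow_of_nonneg _ _ ht0, ENNReal.mul_rpow_of_nonneg _ _ hs0,
    ← ENNReal.rpow_mul, ← ht]
  rw [hσpow, hst, show t * (p / r - 1) * t = t * (1 - t) by rw [← hst]; ring,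
    show (1 - t) * (p / r - 1) * t = (1 - t) ^ 2 by rw [mul_assoc, hst]; ring]
  ring

theorem ENNReal.exists_pos_le_ofReal {K : ℝ≥0∞} (hK : K ≠ ∞) :
    ∃ C : ℝ, 0 < C ∧ K ≤ ENNReal.ofReal C :=
  ⟨K.toReal + 1, by positivity, (ENNReal.le_ofReal_iff_toReal_le hK (by positivity)).2 (by linarith)⟩

end Testing

/-- sharp estimate for the testing constant `𝒯`. -/
theorem stmt11 (n : ℕ) (hn : 1 ≤ n) (p q r α η : ℝ)
    (hp : 1 < p) (hpq : p ≤ q) (hr : 0 < r) (hα : 0 < α) (hα1 : α ≤ 1)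
    (hη : 0 < η) (hη1 : η ≤ 1) (hscale : 0 ≤ -α + 1 / q + (1 - 1 / p)) :
    ∃ C : ℝ, 0 < C ∧
      ∀ ω σ' : (Fin n → ℝ) → ℝ, IsWeight ω → IsWeight σ' →
        AinfChar ω < ∞ → AinfChar σ' < ∞ →
      ∀ S : Set (Cube n), (∀ Q ∈ S, Q.IsDyadic) → IsSparse η S →
        ((p = q ∧ α < 1 ∧ r < p) →
          testT p q r α S ω σ' ≤
            ENNReal.ofReal C * twoWeightChar p q α S ω σ' ^ r *
              (AinfChar σ' ^ (1 - (1 - r / p) ^ 2) * AinfChar ω ^ ((1 - r / p) ^ 2))) ∧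
        (¬(p = q ∧ α < 1 ∧ r < p) →
          testT p q r α S ω σ' ≤
            ENNReal.ofReal C * twoWeightChar p q α S ω σ' ^ r * AinfChar σ' ^ (r / q)) := by
  by_cases h : p = q ∧ α < 1 ∧ r < p
  · obtain ⟨rfl, hα2, hrp⟩ := h
    obtain ⟨K, hK, hbound⟩ := exists_testT_le_diagonal n hη hp hr hrp α
    obtain ⟨C, hC, hKC⟩ := ENNReal.exists_pos_le_ofReal hK
    refine ⟨C, hC, fun ω σ' hω hσ _ _ S hdy hS => ⟨fun _ => ?_, fun h => ?_⟩⟩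
    · exact (hbound ω σ' hω hσ S hdy hS).trans
        (mul_le_mul_left (mul_le_mul_left hKC _) _)
    · exact absurd ⟨rfl, hα2, hrp⟩ h
  · obtain ⟨K, hK, hbound⟩ := exists_testT_le (α := α) n hη hp hpq hr hα fun hpq' hrq => by
      by_contra hne
      exact h ⟨hpq', lt_of_le_of_ne hα1 hne, hpq' ▸ hrq⟩
    obtain ⟨C, hC, hKC⟩ := ENNReal.exists_pos_le_ofReal hK
    refine ⟨C, hC, fun ω σ' hω hσ _ _ S hdy hS => ⟨fun h' => absurd h' h, fun _ => ?_⟩⟩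
    exact (hbound ω σ' hω hσ S hdy hS).trans (mul_le_mul_left (mul_le_mul_left hKC _) _)
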